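/- arXiv:2003.03886 — 5 statements merged into one kernel-verified Lean document; each statement's English description precedes it below -/
import Mathlib

section
/- Converse of the implicit interpolation formula: let k ≥ 0 and n ≥ k+2, and let f be a function on [a,b]. Suppose that for every x ∈ [a,b] with x ∉ {x_1,…,x_n}: f[x_{i−k}, …, x_i, x] = 0 whenever x > x_{k+1}, where i is the smallest index with x_i > x (and i = n when x > x_n); and f[x_1, …, x_{k+1}, x] = 0 whenever x < x_{k+1}. Then f ∈ H^k_n; that is, f is the k-th degree discrete spline with knots in x_{(k+1):(n−1)} interpolating the values f(x_1),…,f(x_n). -/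
open Finset

/-- Divided difference of `f` with respect to a list of centers:
`f[z] = f z`, and `f[z₁,…,z_{r+1}] = (f[z₂,…,z_{r+1}] − f[z₁,…,z_r]) / (z_{r+1} − z₁)`. -/
noncomputable def divDiff (f : ℝ → ℝ) : List ℝ → ℝ
  | [] => 0
  | [z] => f z
  | z :: y :: l =>
      (divDiff f (y :: l) - divDiff f (z :: (y :: l).dropLast)) /
        ((y :: l).getLast (List.cons_ne_nil y l) - z)
  termination_by l => l.length
  decreasing_by
  · simp
  · simp [List.length_dropLast]

/-- The list of centers `x_lo, …, x_hi`. -/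
noncomputable def ctrs (x : ℕ → ℝ) (lo hi : ℕ) : List ℝ :=
  (List.range (hi + 1 - lo)).map fun m => x (lo + m)

/-- The index `i` such that `t ∈ (x_i, x_{i+1}]` (equals `0` when `t ≤ x 1`,
and `n` when `t > x n`): the number of design points strictly below `t`. -/
noncomputable def discrIdx (x : ℕ → ℝ) (n : ℕ) (t : ℝ) : ℕ :=
  ((Finset.Icc 1 n).filter fun i => x i < t).card

/-- The `k`-th order discrete derivative operator `Δ^k_n`. -/
noncomputable def discreteDeriv (x : ℕ → ℝ) (n k : ℕ) (f : ℝ → ℝ) (t : ℝ) : ℝ :=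
  let i := discrIdx x n t
  if k ≤ i then (Nat.factorial k : ℝ) * divDiff f (ctrs x (i + 1 - k) i ++ [t])
  else (Nat.factorial i : ℝ) * divDiff f (ctrs x 1 i ++ [t])

/-- The simple cumulative sum operator `S̄(·; x_{lo:n})`. -/
noncomputable def cumSum (x : ℕ → ℝ) (lo n : ℕ) (f : ℝ → ℝ) (t : ℝ) : ℝ :=
  (∑ j ∈ Finset.Icc lo n, if x j < t then f (x j) else 0) + f t

/-- The weight map `W^k_n`. -/
noncomputable def weightMap (x : ℕ → ℝ) (n k : ℕ) (f : ℝ → ℝ) (t : ℝ) : ℝ :=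
  let i := discrIdx x n t
  if k ≤ i then f t * ((t - x (i + 1 - k)) / k) else f t

/-- The `k`-th order discrete integral operator `S^k_n`:
`S^0 = id`, `S^1 = S̄(·;x_{1:n}) ∘ W^1_n`, and `S^k = S^{k-1} ∘ S̄(·;x_{k:n}) ∘ W^k_n`. -/
noncomputable def discreteInteg (x : ℕ → ℝ) (n : ℕ) : ℕ → (ℝ → ℝ) → ℝ → ℝ
  | 0, f => f
  | k + 1, f => discreteInteg x n k (cumSum x (k + 1) n (weightMap x n (k + 1) f))

/-- The `k`-th degree falling factorial basis function `h^k_j`. -/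
noncomputable def fallFact (x : ℕ → ℝ) (k j : ℕ) (t : ℝ) : ℝ :=
  if j ≤ k + 1 then
    (1 / (Nat.factorial (j - 1) : ℝ)) * ∏ ℓ ∈ Finset.Icc 1 (j - 1), (t - x ℓ)
  else
    (1 / (Nat.factorial k : ℝ)) * (∏ ℓ ∈ Finset.Icc (j - k) (j - 1), (t - x ℓ)) *
      (if x (j - 1) < t then 1 else 0)

/-- Membership in `H^k_n`, the span of the falling factorial basis, as functions on `[a,b]`. -/
def inFFSpan (x : ℕ → ℝ) (n k : ℕ) (a b : ℝ) (f : ℝ → ℝ) : Prop :=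
  ∃ c : ℕ → ℝ, ∀ t ∈ Set.Icc a b, f t = ∑ j ∈ Finset.Icc 1 n, c j * fallFact x k j t

/-- Divided difference of data `v_lo, …, v_{lo+d}` over centers `x_lo, …, x_{lo+d}`. -/
noncomputable def divDiffVec (x v : ℕ → ℝ) : ℕ → ℕ → ℝ
  | lo, 0 => v lo
  | lo, d + 1 => (divDiffVec x v (lo + 1) d - divDiffVec x v lo d) / (x (lo + d + 1) - x lo)

/-- Left derivative. -/
noncomputable def lDeriv (f : ℝ → ℝ) : ℝ → ℝ := fun t => derivWithin f (Set.Iic t) t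

/-- `k`-th derivative, taken as the left derivative where the derivative does not exist. -/
noncomputable def Dk (m : ℕ) (f : ℝ → ℝ) : ℝ → ℝ := lDeriv^[m] f

lemma divDiff_snoc (f : ℝ → ℝ) (z w : ℝ) (l : List ℝ) :
    divDiff f (z :: (l ++ [w])) = (divDiff f (l ++ [w]) - divDiff f (z :: l)) / (w - z) := by
  cases l with
  | nil => simp [divDiff]
  | cons y l =>
    rw [List.cons_append, divDiff]
    congr 2
    · congr 2
      rw [← List.cons_append, List.dropLast_concat]
    · simp

/-- divided difference on x_lo..x_{lo+d}. -/
noncomputable def dl (f : ℝ → ℝ) (x : ℕ → ℝ) (lo d : ℕ) : ℝ := divDiff f (ctrs x lo (lo + d))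

/-- Newton form. -/
noncomputable def NP (f : ℝ → ℝ) (x : ℕ → ℝ) (lo : ℕ) (t : ℝ) : ℕ → ℝ
  | 0 => f (x lo)
  | d + 1 => NP f x lo t d + dl f x lo (d + 1) * ∏ l ∈ Finset.range (d + 1), (t - x (lo + l))

lemma ctrs_snoc (x : ℕ → ℝ) (lo d : ℕ) :
    ctrs x lo (lo + (d + 1)) = ctrs x lo (lo + d) ++ [x (lo + d + 1)] := by
  have e1 : lo + (d + 1) + 1 - lo = d + 1 + 1 := by omega
  have e2 : lo + d + 1 - lo = d + 1 := by omega
  unfold ctrs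
  rw [e1, e2, List.range_succ (n := d + 1)]
  simp [add_assoc]

lemma ctrs_cons (x : ℕ → ℝ) (lo d : ℕ) :
    ctrs x lo (lo + (d + 1)) = x lo :: ctrs x (lo + 1) (lo + 1 + d) := by
  have e1 : lo + (d + 1) + 1 - lo = d + 1 + 1 := by omega
  have e2 : lo + 1 + d + 1 - (lo + 1) = d + 1 := by omega
  unfold ctrs
  rw [e1, e2, List.range_succ_eq_map]
  simp only [List.map_cons, List.map_map, add_zero, Function.comp_def]
  congr 1
  apply List.map_congr_left
  intro m _
  congr 1
  omega

lemma ctrs_zero (x : ℕ → ℝ) (lo : ℕ) : ctrs x lo (lo + 0) = [x lo] := by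
  simp [ctrs]

lemma dl_zero (f : ℝ → ℝ) (x : ℕ → ℝ) (lo : ℕ) : dl f x lo 0 = f (x lo) := by
  rw [dl, ctrs_zero]; simp [divDiff]

lemma dl_succ (f : ℝ → ℝ) (x : ℕ → ℝ) (lo d : ℕ) (h : x lo ≠ x (lo + d + 1)) :
    dl f x lo (d + 1) * (x (lo + d + 1) - x lo) = dl f x (lo + 1) d - dl f x lo d := by
  have h' : x (lo + d + 1) - x lo ≠ 0 := sub_ne_zero.mpr h.symm
  cases d with
  | zero =>
    simp only [dl]
    rw [ctrs_snoc, ctrs_zero, ctrs_zero]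
    have := divDiff_snoc f (x lo) (x (lo + 0 + 1)) []
    simp only [List.nil_append] at this
    simp only [List.cons_append, List.nil_append]
    rw [this]
    rw [div_mul_cancel₀ _ h']
  | succ d =>
    simp only [dl]
    rw [ctrs_cons, ctrs_snoc, ctrs_cons]
    rw [divDiff_snoc]
    have e : lo + 1 + d + 1 = lo + (d + 1) + 1 := by omega
    rw [e, div_mul_cancel₀ _ h']

lemma prod_pull (x : ℕ → ℝ) (t : ℝ) (lo d : ℕ) :
    ∏ l ∈ Finset.range (d + 1), (t - x (lo + l)) =
      (∏ l ∈ Finset.range d, (t - x (lo + 1 + l))) * (t - x lo) := by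
  rw [Finset.prod_range_succ', add_zero]
  congr 1
  exact Finset.prod_congr rfl fun l _ => by rw [add_assoc, add_comm 1 l]

lemma NP_shift (f : ℝ → ℝ) (x : ℕ → ℝ) (n lo d : ℕ) (t : ℝ)
    (hx : ∀ i j, 1 ≤ i → i < j → j ≤ n → x i < x j) (h1 : 1 ≤ lo) (h2 : lo + d + 1 ≤ n) :
    NP f x lo t (d + 1) = NP f x (lo + 1) t d +
      dl f x lo (d + 1) * ∏ l ∈ Finset.range (d + 1), (t - x (lo + 1 + l)) := by
  induction d with
  | zero =>
    have := dl_succ f x lo 0 (hx _ _ h1 (by omega) h2).ne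
    simp [NP, dl_zero] at *
    linarith
  | succ d ih =>
    have := dl_succ f x lo (d + 1) (hx _ _ h1 (by omega) h2).ne
    rw [NP, ih (by omega), NP, prod_pull x t lo (d + 1), Finset.prod_range_succ _ (d + 1)]
    have e2 : lo + 1 + (d + 1) = lo + (d + 1) + 1 := by omega
    rw [e2]
    linear_combination (∏ l ∈ Finset.range (d + 1), (t - x (lo + 1 + l))) * this

lemma NP_step (f : ℝ → ℝ) (x : ℕ → ℝ) (n lo d : ℕ) (t : ℝ)
    (hx : ∀ i j, 1 ≤ i → i < j → j ≤ n → x i < x j) (h1 : 1 ≤ lo) (h2 : lo + d + 1 ≤ n) :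
    NP f x (lo + 1) t d = NP f x lo t d + dl f x lo (d + 1) * (x (lo + d + 1) - x lo) *
      ∏ l ∈ Finset.range d, (t - x (lo + 1 + l)) := by
  have := NP_shift f x n lo d t hx h1 h2
  rw [NP, Finset.prod_range_succ', Finset.prod_range_succ] at this
  have e : ∏ l ∈ Finset.range d, (t - x (lo + (l + 1)))
      = ∏ l ∈ Finset.range d, (t - x (lo + 1 + l)) :=
    Finset.prod_congr rfl fun l _ => by rw [add_assoc, add_comm 1 l]
  have e2 : lo + 1 + d = lo + d + 1 := by omega
  rw [e, e2, add_zero] at this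
  linear_combination -this

lemma NP_err (f : ℝ → ℝ) (x : ℕ → ℝ) (n d : ℕ) (t : ℝ)
    (hx : ∀ i j, 1 ≤ i → i < j → j ≤ n → x i < x j) (ht : ∀ j, 1 ≤ j → j ≤ n → t ≠ x j) :
    ∀ lo, 1 ≤ lo → lo + d ≤ n → 
    f t = NP f x lo t d + divDiff f (ctrs x lo (lo + d) ++ [t]) *
      ∏ l ∈ Finset.range (d + 1), (t - x (lo + l)) := by
  induction d with
  | zero =>
    intro lo h1 h2
    have h' : t - x lo ≠ 0 := sub_ne_zero.mpr (ht lo h1 h2)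
    have := divDiff_snoc f (x lo) t []
    rw [List.nil_append] at this
    rw [ctrs_zero, List.singleton_append, this]
    simp [NP, divDiff]
    field_simp
    ring
  | succ d ih =>
    intro lo h1 h2
    have h' : t - x lo ≠ 0 := sub_ne_zero.mpr (ht lo h1 (by omega))
    rw [NP_shift f x n lo d t hx h1 (by omega), ih (lo + 1) (by omega) (by omega),
      prod_pull x t lo (d + 1), dl]
    rw [ctrs_cons, List.cons_append, divDiff_snoc]
    field_simp
    ring

lemma NP_last (f : ℝ → ℝ) (x : ℕ → ℝ) (n d : ℕ)
    (hx : ∀ i j, 1 ≤ i → i < j → j ≤ n → x i < x j) :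
    ∀ lo, 1 ≤ lo → lo + d ≤ n → NP f x lo (x (lo + d)) d = f (x (lo + d)) := by
  induction d with
  | zero => intro lo _ _; simp [NP]
  | succ d ih =>
    intro lo h1 h2
    rw [NP_shift f x n lo d _ hx h1 (by omega), Finset.prod_range_succ]
    have e : lo + (d + 1) = lo + 1 + d := by omega
    rw [e, ih (lo + 1) (by omega) (by omega)]
    simp

lemma NP_mid (f : ℝ → ℝ) (x : ℕ → ℝ) (n lo j d : ℕ)
    (hx : ∀ i j, 1 ≤ i → i < j → j ≤ n → x i < x j) (h1 : 1 ≤ lo) (h2 : lo + j ≤ n)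
    (hj : j ≤ d) : NP f x lo (x (lo + j)) d = f (x (lo + j)) := by
  induction d, hj using Nat.le_induction with
  | base => exact NP_last f x n j hx lo h1 h2
  | succ d hd ih =>
    rw [NP, ih, Finset.prod_eq_zero (i := j) (Finset.mem_range.mpr (by omega)) (sub_self _)]
    simp

lemma prod_Icc_range (x : ℕ → ℝ) (t : ℝ) (lo d : ℕ) :
    ∏ l ∈ Finset.Icc (lo + 1) (lo + d), (t - x l) =
      ∏ l ∈ Finset.range d, (t - x (lo + 1 + l)) := by
  induction d with
  | zero => simp
  | succ d ih =>
    rw [← add_assoc, Finset.prod_Icc_succ_top (by omega), ih, Finset.prod_range_succ]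
    congr 3
    omega

/-- coefficients -/
noncomputable def cf (f : ℝ → ℝ) (x : ℕ → ℝ) (k j : ℕ) : ℝ :=
  if j ≤ k + 1 then (Nat.factorial (j - 1) : ℝ) * dl f x 1 (j - 1)
  else (Nat.factorial k : ℝ) * (dl f x (j - k - 1) (k + 1) * (x j - x (j - k - 1)))

lemma sum_low (f : ℝ → ℝ) (x : ℕ → ℝ) (k d : ℕ) (t : ℝ) (hd : d ≤ k) :
    ∑ j ∈ Finset.Icc 1 (d + 1), cf f x k j * fallFact x k j t = NP f x 1 t d := by
  induction d with
  | zero => simp [cf, fallFact, NP, dl_zero]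
  | succ d ih =>
    rw [Finset.sum_Icc_succ_top (by omega), ih (by omega), NP, cf, fallFact,
      if_pos (by omega), if_pos (by omega)]
    have := prod_Icc_range x t 0 (d + 1)
    simp only [zero_add] at this
    simp only [Nat.add_sub_cancel]
    rw [this]
    have : (Nat.factorial (d + 1) : ℝ) ≠ 0 := by positivity
    field_simp

lemma sum_mid (f : ℝ → ℝ) (x : ℕ → ℝ) (n k m : ℕ) (t : ℝ)
    (hx : ∀ i j, 1 ≤ i → i < j → j ≤ n → x i < x j) (hm : m + k + 1 ≤ n)
    (ht : m = 0 ∨ x (m + k) < t) :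
    ∑ j ∈ Finset.Icc 1 (m + k + 1), cf f x k j * fallFact x k j t = NP f x (m + 1) t k := by
  induction m with
  | zero => simpa using sum_low f x k k t le_rfl
  | succ m ih =>
    have ht' : x (m + 1 + k) < t := by simpa using ht
    have e : m + 1 + k + 1 = (m + k + 1) + 1 := by omega
    rw [e, Finset.sum_Icc_succ_top (by omega), ih (by omega)
      (by
        rcases Nat.eq_zero_or_pos m with h | h
        · exact Or.inl h
        · exact Or.inr ((hx _ _ (by omega) (by omega) (by omega)).trans ht'))]
    rw [NP_step f x n (m + 1) k t hx (by omega) (by omega), cf, fallFact,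
      if_neg (by omega), if_neg (by omega)]
    have e1 : m + k + 1 + 1 - k - 1 = m + 1 := by omega
    have e2 : m + k + 1 + 1 - k = m + 1 + 1 := by omega
    have e3 : m + k + 1 + 1 - 1 = m + 1 + k := by omega
    have e4 : m + k + 1 + 1 = m + 1 + k + 1 := by omega
    rw [e1, e2, e3, e4, if_pos ht', prod_Icc_range]
    have : (Nat.factorial k : ℝ) ≠ 0 := by positivity
    field_simp

lemma sum_full (f : ℝ → ℝ) (x : ℕ → ℝ) (n k m : ℕ) (t : ℝ)
    (hx : ∀ i j, 1 ≤ i → i < j → j ≤ n → x i < x j) (hm : m + k + 1 ≤ n)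
    (ht : m = 0 ∨ x (m + k) < t) (ht2 : m + k + 1 = n ∨ t ≤ x (m + k + 1)) :
    ∑ j ∈ Finset.Icc 1 n, cf f x k j * fallFact x k j t = NP f x (m + 1) t k := by
  rw [← sum_mid f x n k m t hx hm ht]
  symm
  apply Finset.sum_subset (Finset.Icc_subset_Icc le_rfl hm)
  intro j hj hj'
  simp only [Finset.mem_Icc] at hj hj'
  rw [fallFact, if_neg (by omega)]
  have ht3 : t ≤ x (m + k + 1) := ht2.resolve_left (by omega)
  have : ¬ x (j - 1) < t := by
    rw [not_lt]
    rcases (show m + k + 1 ≤ j - 1 by omega).eq_or_lt with h | h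
    · rwa [← h]
    · exact ht3.trans (hx _ _ (by omega) h (by omega)).le
  rw [if_neg this]
  simp

/-- Corollary: converse of the implicit interpolation formula.
If a function `f` on `[a,b]` satisfies, at every non-design point `t ∈ [a,b]`,
`f[x_{i−k},…,x_i,t] = 0` whenever `t > x_{k+1}` (with `i` the smallest index with
`x_i > t`, and `i = n` when `t > x_n`), and `f[x_1,…,x_{k+1},t] = 0` whenever
`t < x_{k+1}`, then `f ∈ H^k_n`. -/
theorem implicit_interpolation_converse
    (n k : ℕ) (a b : ℝ) (x : ℕ → ℝ)
    (hn : k + 2 ≤ n)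
    (hmono : ∀ i, 1 ≤ i → i < n → x i < x (i + 1))
    (ha : a ≤ x 1) (hb : x n ≤ b) (hab : x (n + 1) = b)
    (f : ℝ → ℝ)
    (h1 : ∀ t ∈ Set.Icc a b, (∀ j ∈ Finset.Icc 1 n, t ≠ x j) → x (k + 1) < t →
      ∀ i ∈ Finset.Icc 1 n,
        ((∀ j ∈ Finset.Icc 1 n, (t < x j ↔ i ≤ j)) ∨ (x n < t ∧ i = n)) →
        divDiff f (ctrs x (i - k) i ++ [t]) = 0)
    (h2 : ∀ t ∈ Set.Icc a b, (∀ j ∈ Finset.Icc 1 n, t ≠ x j) → t < x (k + 1) →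
      divDiff f (ctrs x 1 (k + 1) ++ [t]) = 0) :
    inFFSpan x n k a b f := by
  have hx : ∀ i j, 1 ≤ i → i < j → j ≤ n → x i < x j := by
    intro i j hi hij
    induction j, hij using Nat.le_induction with
    | base => intro h; exact hmono i hi h
    | succ j hj ih => 
      intro h
      have hj' : i < j := hj
      exact (ih (by omega)).trans (hmono j (by omega) h)
  refine ⟨cf f x k, fun t ht => ?_⟩
  rcases le_or_gt t (x (k + 1)) with hk | hk
  · rw [sum_full f x n k 0 t hx (by omega) (Or.inl rfl) (Or.inr (by simpa using hk))]
    by_cases hd : ∃ j, 1 ≤ j ∧ j ≤ n ∧ t = x j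
    · obtain ⟨j, hj1, hj2, rfl⟩ := hd
      have hjk : j ≤ k + 1 := by
        by_contra hc
        exact absurd (hx (k + 1) j (by omega) (by omega) hj2) (not_lt.mpr hk)
      obtain ⟨j, rfl⟩ : ∃ i, j = 1 + i := ⟨j - 1, by omega⟩
      exact (NP_mid f x n 1 j k hx le_rfl hj2 (by omega)).symm
    · push Not at hd
      have h := h2 t ht (fun j hj => by
        rw [Finset.mem_Icc] at hj; exact hd j hj.1 hj.2)
        (lt_of_le_of_ne hk (hd _ (by omega) (by omega)))
      have := NP_err f x n k t hx hd 1 le_rfl (by omega)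
      rw [add_comm 1 k, h] at this
      simpa using this
  · obtain ⟨m, hm, hm1, hm2⟩ : ∃ m, m + k + 1 ≤ n ∧ x (m + k) < t ∧
        ((m + k + 1 = n ∧ x n < t) ∨ t ≤ x (m + k + 1)) ∧ 1 ≤ m := by
      by_cases hnt : x n < t
      · refine ⟨n - k - 1, by omega, ?_, Or.inl ⟨by omega, hnt⟩, by omega⟩
        exact (hx _ _ (by omega) (by omega) le_rfl).trans hnt
      · have hex : ∃ m, t ≤ x (m + k + 1) := 
          ⟨n - k - 1, by rw [show n - k - 1 + k + 1 = n by omega]; exact not_lt.mp hnt⟩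
        classical
        have hs := Nat.find_spec hex
        have hle : Nat.find hex ≤ n - k - 1 := Nat.find_min' hex
          (by rw [show n - k - 1 + k + 1 = n by omega]; exact not_lt.mp hnt)
        have hpos : 1 ≤ Nat.find hex := by
          by_contra hc
          have h0 : Nat.find hex = 0 := by omega
          rw [h0, zero_add] at hs
          exact absurd hk (not_lt.mpr hs)
        refine ⟨Nat.find hex, by omega, ?_, Or.inr hs, hpos⟩
        have := Nat.find_min hex (m := Nat.find hex - 1) (by omega)
        rw [show Nat.find hex - 1 + k + 1 = Nat.find hex + k by omega] at this
        exact not_le.mp this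
    obtain ⟨hm2, hmpos⟩ := hm2
    rw [sum_full f x n k m t hx hm (Or.inr hm1) (hm2.imp (fun h => h.1) id)]
    by_cases hd : ∃ j, 1 ≤ j ∧ j ≤ n ∧ t = x j
    · obtain ⟨j, hj1, hj2, rfl⟩ := hd
      have hjk : m + k < j := by
        by_contra hc
        rcases (not_lt.mp hc).eq_or_lt with h | h
        · rw [h] at hm1; exact lt_irrefl _ hm1
        · exact lt_asymm hm1 (hx _ _ hj1 h (by omega))
      have hj : j = m + 1 + k := by
        rcases hm2 with h | h
        · omega
        · by_contra hc
          exact absurd (hx (m + k + 1) j (by omega) (by omega) hj2) (not_lt.mpr h)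
      subst hj
      exact (NP_last f x n k hx (m + 1) (by omega) (by omega)).symm
    · push Not at hd
      have h := h1 t ht (fun j hj => by
        rw [Finset.mem_Icc] at hj; exact hd j hj.1 hj.2) hk (m + 1 + k)
        (Finset.mem_Icc.mpr ⟨by omega, by omega⟩) (by
          rcases hm2 with h | h
          · exact Or.inr ⟨h.2, by omega⟩
          · left
            intro j hj
            rw [Finset.mem_Icc] at hj
            constructor
            · intro hlt
              by_contra hc
              rcases (show j ≤ m + k by omega).eq_or_lt with h' | h'
              · rw [h'] at hlt; exact lt_asymm hm1 hlt
              · exact lt_asymm (hm1.trans hlt) (hx _ _ hj.1 h' (by omega))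
            · intro hle
              refine lt_of_le_of_ne ?_ (hd j hj.1 hj.2)
              rcases hle.eq_or_lt with h' | h'
              · rw [← h', show m + 1 + k = m + k + 1 by omega]; exact h
              · rw [show m + 1 + k = m + k + 1 by omega] at h'
                exact h.trans (hx _ _ (by omega) h' hj.2).le)
      have := NP_err f x n k t hx hd (m + 1) (by omega) (by omega)
      rw [show m + 1 + k - k = m + 1 by omega] at h
      rw [h] at this
      simpa using this
end

section
/- Discrete B-spline evaluations at the design points: let k ≥ 0 and n ≥ 1, and fix boundary points x_{−(k−1)} < ⋯ < x_{−1} < x_0 = a < x_1, together with x_{n+1} = b. For i, j ∈ {1,…,n}, define N^k_j(x_i) = (x_{j+1} − x_{j−k}) · g_i[x_{j−k}, …, x_{j+1}], the scaled (k+1)-st order divided difference, with centers x_{j−k},…,x_{j+1}, of the truncated Newton polynomial g_i(z) = η₊(z; x_{(i−k+1):i}) = ∏_{ℓ=i−k+1}^{i}(z − x_ℓ)·1{z > x_i}. Then N^k_j(x_i) = 1 if i = j, and N^k_j(x_i) = 0 otherwise. -/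
open Finset

/-- The list of centers `x_lo, …, x_hi` (integer-indexed design points). -/
noncomputable def ctrsZ (x : ℤ → ℝ) (lo hi : ℤ) : List ℝ :=
  (List.range ((hi - lo).toNat + 1)).map fun m => x (lo + m)

/-- Divided difference of order `m` starting at index `lo`. -/
noncomputable def ddZ (f : ℝ → ℝ) (x : ℤ → ℝ) (m : ℕ) (lo : ℤ) : ℝ :=
  divDiff f ((List.range (m + 1)).map fun t : ℕ => x (lo + t))

theorem ddZ_zero (f : ℝ → ℝ) (x : ℤ → ℝ) (lo : ℤ) : ddZ f x 0 lo = f (x lo) := by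
  simp [ddZ, divDiff]

theorem divDiff_step (f : ℝ → ℝ) (z : ℝ) (l : List ℝ) (h : l ≠ []) :
    divDiff f (z :: l) = (divDiff f l - divDiff f (z :: l.dropLast)) / (l.getLast h - z) := by
  cases l with
  | nil => exact absurd rfl h
  | cons y l => rw [divDiff]

theorem ddZ_succ (f : ℝ → ℝ) (x : ℤ → ℝ) (m : ℕ) (lo : ℤ) :
    ddZ f x (m + 1) lo =
      (ddZ f x m (lo + 1) - ddZ f x m lo) / (x (lo + (m + 1 : ℕ)) - x lo) := by
  have e1 : ((List.range (m + 1 + 1)).map fun t : ℕ => x (lo + t)) =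
      x lo :: ((List.range (m + 1)).map fun t : ℕ => x (lo + 1 + t)) := by
    rw [List.range_succ_eq_map]
    simp only [List.map_cons, List.map_map]
    congr 1
    · simp
    · apply List.map_congr_left
      intro t _
      simp only [Function.comp]
      congr 1
      push_cast
      ring
  have e2 : ((List.range (m + 1)).map fun t : ℕ => x (lo + 1 + t)) =
      ((List.range m).map fun t : ℕ => x (lo + 1 + t)) ++ [x (lo + (m + 1 : ℕ))] := by
    rw [List.range_succ]
    simp only [List.map_append, List.map_cons, List.map_nil]
    congr 3
    push_cast
    ring
  have e3 : ((List.range (m + 1)).map fun t : ℕ => x (lo + t)) =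
      x lo :: ((List.range m).map fun t : ℕ => x (lo + 1 + t)) := by
    rw [List.range_succ_eq_map]
    simp only [List.map_cons, List.map_map]
    congr 1
    · simp
    · apply List.map_congr_left
      intro t _
      simp only [Function.comp]
      congr 1
      push_cast
      ring
  have hne : ((List.range (m + 1)).map fun t : ℕ => x (lo + 1 + t)) ≠ [] := by simp
  unfold ddZ
  rw [e1, divDiff_step f _ _ hne, e3]
  congr 2
  · congr 2
    rw [e2, List.dropLast_concat]
  · simp only [e2, List.getLast_concat]

theorem ddZ_congr (f g : ℝ → ℝ) (x : ℤ → ℝ) (m : ℕ) : ∀ lo : ℤ,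
    (∀ u : ℤ, lo ≤ u → u ≤ lo + m → f (x u) = g (x u)) → ddZ f x m lo = ddZ g x m lo := by
  induction m with
  | zero => intro lo h; rw [ddZ_zero, ddZ_zero]; exact h lo le_rfl (by simp)
  | succ m ih =>
    intro lo h
    rw [ddZ_succ, ddZ_succ, ih (lo + 1), ih lo]
    · intro u h1 h2; exact h u h1 (by push_cast; omega)
    · intro u h1 h2; exact h u (by omega) (by push_cast; omega)

theorem ddZ_const_zero (x : ℤ → ℝ) (m : ℕ) : ∀ lo : ℤ, ddZ (fun _ => 0) x m lo = 0 := by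
  induction m with
  | zero => intro lo; rw [ddZ_zero]
  | succ m ih => intro lo; rw [ddZ_succ, ih, ih]; simp

theorem ddZ_const_one (x : ℤ → ℝ) (m : ℕ) : ∀ lo : ℤ,
    ddZ (fun _ => 1) x m lo = if 0 = m then 1 else 0 := by
  induction m with
  | zero => intro lo; rw [ddZ_zero]; simp
  | succ m ih => intro lo; rw [ddZ_succ, ih, ih]; simp

theorem ddZ_mul (x : ℤ → ℝ) (L H : ℤ)
    (hx : ∀ u v : ℤ, L ≤ u → u < v → v ≤ H → x u < x v) (c : ℝ) (h : ℝ → ℝ) (m : ℕ) :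
    ∀ lo : ℤ, L ≤ lo → lo + (m + 1 : ℕ) ≤ H →
      ddZ (fun z => (z - c) * h z) x (m + 1) lo =
        (x (lo + (m + 1 : ℕ)) - c) * ddZ h x (m + 1) lo + ddZ h x m lo := by
  induction m with
  | zero =>
    intro lo h1 h2
    have := hx lo (lo + (0 + 1 : ℕ)) h1 (by push_cast; omega) h2
    have h3 : x (lo + (0 + 1 : ℕ)) - x lo ≠ 0 := by linarith
    rw [ddZ_succ, ddZ_succ]
    simp only [ddZ_zero]
    have e : lo + ((0 + 1 : ℕ) : ℤ) = lo + 1 := by simp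
    rw [e] at h3 ⊢
    field_simp
    ring
  | succ m ih =>
    intro lo h1 h2
    have q1 := hx lo (lo + (m + 1 + 1 : ℕ)) h1 (by push_cast; omega) h2
    have q2 := hx lo (lo + (m + 1 : ℕ)) h1 (by push_cast; omega) (by push_cast at h2 ⊢; omega)
    have h3 : x (lo + (m + 1 + 1 : ℕ)) - x lo ≠ 0 := by linarith
    have h4 : x (lo + (m + 1 : ℕ)) - x lo ≠ 0 := by linarith
    rw [ddZ_succ _ x (m + 1), ddZ_succ h x (m + 1), ih lo h1 (by push_cast at h2 ⊢; omega),
      ih (lo + 1) (by omega) (by push_cast at h2 ⊢; omega)]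
    have e : lo + 1 + ((m + 1 : ℕ) : ℤ) = lo + (m + 1 + 1 : ℕ) := by push_cast; ring
    rw [e]
    have r := ddZ_succ h x m lo
    rw [eq_div_iff h4] at r
    have r' : ddZ h x m (lo + 1) =
      ddZ h x (m + 1) lo * (x (lo + (m + 1 : ℕ)) - x lo) + ddZ h x m lo := by linarith
    rw [r']
    field_simp
    ring

theorem ddZ_prod (x : ℤ → ℝ) (L H : ℤ)
    (hx : ∀ u v : ℤ, L ≤ u → u < v → v ≤ H → x u < x v) (S : Finset ℤ) :
    ∀ m : ℕ, S.card ≤ m → ∀ lo : ℤ, L ≤ lo → lo + m ≤ H →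
      ddZ (fun z => ∏ l ∈ S, (z - x l)) x m lo = if S.card = m then 1 else 0 := by
  induction S using Finset.induction_on with
  | empty =>
    intro m _ lo _ _
    simp only [Finset.prod_empty, Finset.card_empty]
    rw [ddZ_const_one x m lo]
    by_cases h : 0 = m <;> simp [h]
  | insert s S hs ih =>
    intro m hm lo h1 h2
    simp only [Finset.prod_insert hs]
    rw [Finset.card_insert_of_notMem hs] at hm ⊢
    obtain ⟨m, rfl⟩ : ∃ m', m = m' + 1 := ⟨m - 1, by omega⟩
    rw [ddZ_mul x L H hx (x s) _ m lo h1 h2, ih (m + 1) (by omega) lo h1 h2,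
      ih m (by omega) lo h1 (by push_cast at h2; omega), if_neg (by omega)]
    simp

theorem mono_chain (x : ℤ → ℝ) (L N : ℤ)
    (hm : ∀ i : ℤ, L ≤ i → i ≤ N → x i < x (i + 1)) :
    ∀ u v : ℤ, L ≤ u → u < v → v ≤ N + 1 → x u < x v := by
  intro u v hu huv
  induction v, huv using Int.le_induction with
  | base => intro h; exact hm u hu (by omega)
  | succ v hv ih => intro h; exact (ih (by omega)).trans (hm v (by omega) (by omega))

theorem ddZ_trunc (n k : ℕ) (x : ℤ → ℝ)
    (hx : ∀ u v : ℤ, 1 - (k : ℤ) ≤ u → u < v → v ≤ (n : ℤ) + 1 → x u < x v)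
    (i : ℕ) (hi : 1 ≤ i) (hin : i ≤ n) (lo : ℤ) (h1 : 1 - (k : ℤ) ≤ lo) (h2 : lo + k ≤ n + 1) :
    ddZ (fun z => (∏ l ∈ Finset.Icc ((i : ℤ) - k + 1) (i : ℤ), (z - x l)) *
              (if x (i : ℤ) < z then 1 else 0)) x k lo = if (i : ℤ) < lo + k then 1 else 0 := by
  split_ifs with hc
  · have hcard : (Finset.Icc ((i : ℤ) - k + 1) (i : ℤ)).card = k := by
      rw [Int.card_Icc]; omega
    have := ddZ_prod x (1 - k) (n + 1) hx (Finset.Icc ((i : ℤ) - k + 1) (i : ℤ)) k hcard.le lo h1 h2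
    rw [if_pos hcard] at this
    refine (ddZ_congr _ _ x k lo ?_).trans this
    intro u hu1 hu2
    by_cases hui : (i : ℤ) < u
    · rw [if_pos (hx i u (by omega) hui (by omega)), mul_one]
    · have hz : (∏ l ∈ Finset.Icc ((i : ℤ) - k + 1) (i : ℤ), (x u - x l)) = 0 :=
        Finset.prod_eq_zero (i := u) (by rw [Finset.mem_Icc]; omega) (sub_self _)
      rw [hz, zero_mul]
  · refine (ddZ_congr _ _ x k lo ?_).trans (ddZ_const_zero x k lo)
    intro u hu1 hu2
    have : x u ≤ x i := by
      rcases eq_or_lt_of_le (show u ≤ i by omega) with h | h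
      · rw [h]
      · exact (hx u i (by omega) h (by omega)).le
    rw [if_neg (not_lt.mpr this), mul_zero]

/-- Lemma: discrete B-spline evaluations at the design points.
With boundary points `x_{−(k−1)} < ⋯ < x_0 = a < x_1 < ⋯ < x_n < x_{n+1} = b`, and
`N^k_j(x_i) = (x_{j+1} − x_{j−k})·g_i[x_{j−k},…,x_{j+1}]` for the truncated Newton
polynomial `g_i(z) = ∏_{ℓ=i−k+1}^i (z − x_ℓ)·1{z > x_i}`, one has `N^k_j(x_i) = δ_{ij}`
for all `i, j ∈ {1,…,n}`. -/
theorem discrete_bspline_evals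
    (n k : ℕ) (a b : ℝ) (x : ℤ → ℝ)
    (hn : 1 ≤ n)
    (hmono : ∀ i : ℤ, 1 - (k : ℤ) ≤ i → i ≤ (n : ℤ) → x i < x (i + 1))
    (hx0 : x 0 = a) (hxb : x ((n : ℤ) + 1) = b) :
    ∀ i ∈ Finset.Icc 1 n, ∀ j ∈ Finset.Icc 1 n,
      (x ((j : ℤ) + 1) - x ((j : ℤ) - k)) *
          divDiff
            (fun z => (∏ ℓ ∈ Finset.Icc ((i : ℤ) - k + 1) (i : ℤ), (z - x ℓ)) *
              (if x (i : ℤ) < z then 1 else 0))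
            (ctrsZ x ((j : ℤ) - k) ((j : ℤ) + 1))
        = if i = j then 1 else 0 := by
  intro i hi j hj
  rw [Finset.mem_Icc] at hi hj
  have hx := mono_chain x (1 - k) n hmono
  have e : ((j : ℤ) + 1 - (j - k)).toNat + 1 = (k + 1) + 1 := by omega
  have t1 := ddZ_trunc n k x hx i hi.1 hi.2 (j - k) (by omega) (by omega)
  have t2 := ddZ_trunc n k x hx i hi.1 hi.2 (j - k + 1) (by omega) (by omega)
  have ec : ctrsZ x ((j : ℤ) - k) ((j : ℤ) + 1) =
      (List.range (k + 1 + 1)).map fun t : ℕ => x ((j : ℤ) - k + t) := by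
    unfold ctrsZ
    rw [e]
    simp [List.map_flatMap, ← List.map_eq_flatMap]
  rw [ec]
  change _ * ddZ _ x (k + 1) ((j : ℤ) - k) = _
  rw [ddZ_succ, t1, t2]
  have e2 : (j : ℤ) - k + (k + 1 : ℕ) = j + 1 := by push_cast; ring
  have q := hx (j - k) (j + 1) (by omega) (by omega) (by omega)
  rw [e2, mul_div_cancel₀ _ (by linarith)]
  split_ifs <;> first | omega | simp
end

section
/- L2-Sobolev representation for discrete splines: let m ≥ 1, k = 2m−1, and n ≥ k+2. There exists a symmetric positive semidefinite matrix V^m_n ∈ ℝ^{(n−m)×(n−m)}, depending only on x_1,…,x_n (and a, b), which is banded of bandwidth 2m−1 (i.e., (V^m_n)_{ij} = 0 whenever |i−j| ≥ m), such that for every f ∈ H^k_n, ∫_a^b (D^m f)(x)² dx = (D^m_n f(x_{1:n}))ᵀ V^m_n (D^m_n f(x_{1:n})), where f(x_{1:n}) = (f(x_1),…,f(x_n)) ∈ ℝ^n. -/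
open Finset

open Polynomial in
noncomputable def srNev (x v : ℕ → ℝ) : ℕ → ℕ → ℝ[X]
  | lo, 0 => C (v lo)
  | lo, d + 1 => C (x (lo + d + 1) - x lo)⁻¹ *
      ((X - C (x lo)) * srNev x v (lo + 1) d - (X - C (x (lo + d + 1))) * srNev x v lo d)

open Polynomial in
lemma srNev_deg (x v : ℕ → ℝ) (d : ℕ) : ∀ lo, (srNev x v lo d).natDegree ≤ d := by
  induction d with
  | zero => intro lo; simp [srNev]
  | succ d ih =>
    intro lo
    rw [srNev]
    refine (natDegree_C_mul_le _ _).trans ((natDegree_sub_le _ _).trans (max_le ?_ ?_))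
    · refine natDegree_mul_le.trans ?_
      have := ih (lo + 1)
      rw [natDegree_X_sub_C]; omega
    · refine natDegree_mul_le.trans ?_
      have := ih lo
      rw [natDegree_X_sub_C]; omega

open Polynomial in
lemma srNev_coeff (x v : ℕ → ℝ) (d : ℕ) :
    ∀ lo, (srNev x v lo d).coeff d = divDiffVec x v lo d := by
  induction d with
  | zero => intro lo; simp [srNev, divDiffVec]
  | succ d ih =>
    intro lo
    have h1 : (srNev x v lo d).coeff (d + 1) = 0 :=
      coeff_eq_zero_of_natDegree_lt (Nat.lt_succ_of_le (srNev_deg x v d lo))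
    have h2 : (srNev x v (lo + 1) d).coeff (d + 1) = 0 :=
      coeff_eq_zero_of_natDegree_lt (Nat.lt_succ_of_le (srNev_deg x v d (lo + 1)))
    rw [srNev, divDiffVec, coeff_C_mul, coeff_sub, sub_mul, sub_mul, coeff_sub, coeff_sub,
      coeff_X_mul, coeff_X_mul, coeff_C_mul, coeff_C_mul, h1, h2, ih, ih, div_eq_inv_mul]
    ring

open Polynomial in
lemma srNev_eval (x v : ℕ → ℝ) (d : ℕ) :
    ∀ lo, (∀ i j, lo ≤ i → i < j → j ≤ lo + d → x i < x j) →
      ∀ l, lo ≤ l → l ≤ lo + d → (srNev x v lo d).eval (x l) = v l := by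
  induction d with
  | zero =>
    intro lo _ l h1 h2
    have : l = lo := by omega
    simp [srNev, this]
  | succ d ih =>
    intro lo hx l h1 h2
    have hne : x (lo + d + 1) - x lo ≠ 0 :=
      sub_ne_zero.2 (hx lo (lo + d + 1) le_rfl (by omega) (by omega)).ne'
    have ih1 := ih (lo + 1) (fun i j a b c => hx i j (by omega) b (by omega)) l
    have ih2 := ih lo (fun i j a b c => hx i j (by omega) b (by omega)) l h1
    simp only [srNev, eval_mul, eval_sub, eval_C, eval_X]
    rcases Nat.eq_or_lt_of_le h1 with h | h
    · subst h
      rw [ih2 (by omega)]; field_simp; ring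
    · rw [ih1 h (by omega)]
      rcases Nat.eq_or_lt_of_le h2 with h' | h'
      · have : l = lo + d + 1 := by omega
        subst this
        field_simp; ring
      · rw [ih2 (by omega)]; field_simp; ring

open Polynomial in
lemma sr_unique (x : ℕ → ℝ) (lo d : ℕ)
    (hx : ∀ i j, lo ≤ i → i < j → j ≤ lo + d → x i < x j) (p : ℝ[X]) (hp : p.natDegree ≤ d)
    (h : ∀ l, lo ≤ l → l ≤ lo + d → p.eval (x l) = 0) : p = 0 := by
  refine eq_zero_of_natDegree_lt_card_of_eval_eq_zero p (ι := Fin (d + 1))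
    (f := fun i => x (lo + i)) ?_ ?_ ?_
  · intro i j hij
    by_contra hne
    rcases lt_or_gt_of_ne hne with h' | h'
    · exact (hx (lo + i) (lo + j) (by omega) (by omega) (by omega)).ne hij
    · exact (hx (lo + j) (lo + i) (by omega) (by omega) (by omega)).ne' hij
  · intro i
    exact h _ (by omega) (by omega)
  · simp; omega

lemma sr_dd_congr (x v w : ℕ → ℝ) (d : ℕ) :
    ∀ lo, (∀ l, lo ≤ l → l ≤ lo + d → v l = w l) →
      divDiffVec x v lo d = divDiffVec x w lo d := by
  induction d with
  | zero => intro lo h; simpa [divDiffVec] using h lo le_rfl (by omega)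
  | succ d ih =>
    intro lo h
    rw [divDiffVec, divDiffVec, ih lo (fun l a b => h l a (by omega)),
      ih (lo + 1) (fun l a b => h l (by omega) (by omega))]

open Polynomial in
lemma sr_coeff (x : ℕ → ℝ) (lo d : ℕ)
    (hx : ∀ i j, lo ≤ i → i < j → j ≤ lo + d → x i < x j) (p : ℝ[X]) (hp : p.natDegree ≤ d) :
    divDiffVec x (fun l => p.eval (x l)) lo d = p.coeff d := by
  have h : p - srNev x (fun l => p.eval (x l)) lo d = 0 := by
    refine sr_unique x lo d hx _ ((natDegree_sub_le _ _).trans (max_le hp (srNev_deg _ _ _ _))) ?_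
    intro l h1 h2
    rw [eval_sub, srNev_eval _ _ _ _ hx l h1 h2, sub_self]
  rw [← srNev_coeff, ← sub_eq_zero.1 h]

lemma sr_comb (x : ℕ → ℝ) (m e : ℕ) : ∀ lo, ∃ w : ℕ → ℝ, ∀ v : ℕ → ℝ,
    divDiffVec x v lo (m + e) = ∑ s ∈ Finset.Icc lo (lo + e), w s * divDiffVec x v s m := by
  induction e with
  | zero => intro lo; exact ⟨fun _ => 1, fun v => by simp⟩
  | succ e ih =>
    intro lo
    obtain ⟨w1, h1⟩ := ih lo
    obtain ⟨w2, h2⟩ := ih (lo + 1)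
    refine ⟨fun s => ((if lo + 1 ≤ s then w2 s else 0) - (if s ≤ lo + e then w1 s else 0)) /
      (x (lo + (m + e) + 1) - x lo), fun v => ?_⟩
    rw [← add_assoc, divDiffVec, h1, h2]
    have e1 : ∑ s ∈ Finset.Icc (lo + 1) (lo + 1 + e), w2 s * divDiffVec x v s m =
        ∑ s ∈ Finset.Icc lo (lo + (e + 1)),
          (if lo + 1 ≤ s then w2 s else 0) * divDiffVec x v s m := by
      simp only [ite_mul, zero_mul]
      rw [← Finset.sum_filter]
      refine Finset.sum_congr ?_ fun _ _ => rfl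
      ext s; simp only [Finset.mem_Icc, Finset.mem_filter]; omega
    have e2 : ∑ s ∈ Finset.Icc lo (lo + e), w1 s * divDiffVec x v s m =
        ∑ s ∈ Finset.Icc lo (lo + (e + 1)),
          (if s ≤ lo + e then w1 s else 0) * divDiffVec x v s m := by
      simp only [ite_mul, zero_mul]
      rw [← Finset.sum_filter]
      refine Finset.sum_congr ?_ fun _ _ => rfl
      ext s; simp only [Finset.mem_Icc, Finset.mem_filter]; omega
    rw [e1, e2, ← Finset.sum_sub_distrib, Finset.sum_div]
    refine Finset.sum_congr rfl fun s _ => ?_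
    ring

open Polynomial in
lemma sr_deriv (x : ℕ → ℝ) (lo m e : ℕ)
    (hx : ∀ i j, lo ≤ i → i < j → j ≤ lo + (m + e) → x i < x j) :
    ∃ φ : ℕ → ℝ[X], ∀ p : ℝ[X], p.natDegree ≤ m + e →
      derivative^[m] p = ∑ s ∈ Finset.Icc lo (lo + e),
        C (divDiffVec x (fun l => p.eval (x l)) s m) * φ s := by
  induction e with
  | zero =>
    refine ⟨fun _ => C (m.factorial : ℝ), fun p hp => ?_⟩
    have h1 : (derivative^[m] p).natDegree ≤ 0 := by
      refine (natDegree_iterate_derivative p m).trans ?_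
      omega
    rw [eq_C_of_natDegree_le_zero h1, coeff_iterate_derivative]
    simp only [add_zero, Finset.Icc_self, Finset.sum_singleton, zero_add,
      Nat.descFactorial_self]
    rw [sr_coeff x lo m hx p hp, ← C_mul]
    simp [mul_comm]
  | succ e ih =>
    obtain ⟨φ, hφ⟩ := ih (fun i j a b c => hx i j a b (by omega))
    obtain ⟨w, hw⟩ := sr_comb x m (e + 1) lo
    let N : ℝ[X] := ∏ i ∈ Finset.range (m + e + 1), (X - C (x (lo + i)))
    have hN : N.Monic := monic_prod_of_monic _ _ fun i _ => monic_X_sub_C _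
    have hNd : N.natDegree = m + e + 1 := by
      simp [N]
    refine ⟨fun s => (if s ≤ lo + e then φ s else 0) + C (w s) * derivative^[m] N,
      fun p hp => ?_⟩
    let q := p - C (p.coeff (m + e + 1)) * N
    have hq : q.natDegree ≤ m + e := by
      rw [natDegree_le_iff_coeff_eq_zero]
      intro r hr
      rcases Nat.eq_or_lt_of_le (Nat.succ_le_of_lt hr) with h | h
      · subst h
        have : N.coeff (m + e + 1) = 1 := by rw [← hNd]; exact hN
        simp [q, this]
      · have a1 : p.coeff r = 0 := coeff_eq_zero_of_natDegree_lt (by omega)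
        have a2 : N.coeff r = 0 := coeff_eq_zero_of_natDegree_lt (by omega)
        simp [q, a1, a2]
    have hqe : ∀ l, lo ≤ l → l ≤ lo + (m + e) → q.eval (x l) = p.eval (x l) := by
      intro l h1 h2
      have : N.eval (x l) = 0 := by
        rw [eval_prod]
        refine Finset.prod_eq_zero (i := l - lo) (Finset.mem_range.2 (by omega)) ?_
        rw [show lo + (l - lo) = l by omega]; simp
      simp [q, this]
    have hpq : p = q + C (p.coeff (m + e + 1)) * N := by simp [q]
    have hc := hw (fun l => p.eval (x l))
    rw [sr_coeff x lo (m + (e + 1)) hx p hp, ← add_assoc] at hc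
    have e2 : derivative^[m] q = ∑ s ∈ Finset.Icc lo (lo + (e + 1)),
        C (divDiffVec x (fun l => p.eval (x l)) s m) * (if s ≤ lo + e then φ s else 0) := by
      rw [hφ q hq]
      simp only [mul_ite, mul_zero]
      rw [← Finset.sum_filter]
      refine Finset.sum_congr ?_ fun s hs => ?_
      · ext s; simp only [Finset.mem_Icc, Finset.mem_filter]; omega
      · simp only [Finset.mem_Icc, Finset.mem_filter] at hs
        rw [sr_dd_congr x _ (fun l => p.eval (x l)) m s]
        intro l h1 h2
        exact hqe l (by omega) (by omega)
    conv_lhs => rw [hpq]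
    rw [iterate_map_add, Polynomial.iterate_derivative_C_mul, e2, hc, map_sum, Finset.sum_mul,
      ← Finset.sum_add_distrib]
    refine Finset.sum_congr rfl fun s _ => ?_
    rw [C_mul]; ring

open Polynomial in
lemma sr_Dk (m : ℕ) (u v : ℝ) : ∀ (f : ℝ → ℝ) (p : ℝ[X]),
    (∀ t ∈ Set.Ioc u v, f t = p.eval t) →
    ∀ t ∈ Set.Ioc u v, Dk m f t = (derivative^[m] p).eval t := by
  induction m with
  | zero => intro f p h t ht; simpa [Dk] using h t ht
  | succ m ih =>
    intro f p h t ht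
    have := ih (lDeriv f) (derivative p) (fun t ht => by
      unfold lDeriv
      have h1 : f =ᶠ[nhdsWithin t (Set.Iic t)] fun s => p.eval s := by
        filter_upwards [Ioc_mem_nhdsLE ht.1] with s hs
        exact h s ⟨hs.1, hs.2.trans ht.2⟩
      rw [h1.derivWithin_eq (h t ht)]
      exact (p.hasDerivAt t).hasDerivWithinAt.derivWithin (uniqueDiffWithinAt_Iic t)) t ht
    simpa [Dk] using this

open Polynomial in
noncomputable def srH (x : ℕ → ℝ) (k j : ℕ) : ℝ[X] :=
  if j ≤ k + 1 then
    C (1 / (Nat.factorial (j - 1) : ℝ)) * ∏ ℓ ∈ Finset.Icc 1 (j - 1), (X - C (x ℓ))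
  else
    C (1 / (Nat.factorial k : ℝ)) * (∏ ℓ ∈ Finset.Icc (j - k) (j - 1), (X - C (x ℓ)))

open Polynomial in
lemma srH_deg (x : ℕ → ℝ) (k j : ℕ) : (srH x k j).natDegree ≤ k := by
  unfold srH
  split_ifs with h
  · refine (natDegree_C_mul_le _ _).trans ?_
    rw [natDegree_finsetProd_X_sub_C_eq_card]; simp; omega
  · refine (natDegree_C_mul_le _ _).trans ?_
    rw [natDegree_finsetProd_X_sub_C_eq_card]; simp; omega

open Polynomial in
lemma srH_eval (x : ℕ → ℝ) (k j : ℕ) (t : ℝ) :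
    fallFact x k j t = if k + 1 < j ∧ t ≤ x (j - 1) then 0 else (srH x k j).eval t := by
  unfold fallFact srH
  by_cases h : j ≤ k + 1
  · have : ¬ (k + 1 < j) := by omega
    simp [h, this, eval_prod]
  · have h' : k + 1 < j := by omega
    by_cases h2 : x (j - 1) < t
    · simp [h, h', h2, eval_prod]
    · simp [h, h', h2, not_lt.1 h2]

open Polynomial in
lemma srH_zero (x : ℕ → ℝ) (k j l : ℕ) (h : k + 1 < j) (h1 : j - k ≤ l) (h2 : l ≤ j - 1) :
    (srH x k j).eval (x l) = 0 := by
  unfold srH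
  rw [if_neg (by omega), eval_mul, eval_prod,
    Finset.prod_eq_zero (i := l) (Finset.mem_Icc.2 ⟨h1, h2⟩) (by simp), mul_zero]

open Polynomial in
lemma sr_qf (k n M : ℕ) (y : ℕ → ℝ) (ψ : ℕ → ℕ → ℝ[X]) (u : ℕ → ℝ) :
    ∑ i ∈ Finset.Icc 1 M, ∑ j ∈ Finset.Icc 1 M,
      u i * (∑ r ∈ Finset.Ico k n, ∫ t in (y r)..(y (r + 1)), (ψ r i * ψ r j).eval t) * u j =
    ∑ r ∈ Finset.Ico k n, ∫ t in (y r)..(y (r + 1)),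
      ((∑ i ∈ Finset.Icc 1 M, C (u i) * ψ r i).eval t) ^ 2 := by
  have hI : ∀ (p : ℝ[X]) (c d : ℝ), IntervalIntegrable (fun t => p.eval t)
      MeasureTheory.volume c d := fun p c d => p.continuous.intervalIntegrable c d
  have h : ∀ r, ∫ t in (y r)..(y (r + 1)), ((∑ i ∈ Finset.Icc 1 M, C (u i) * ψ r i).eval t) ^ 2 =
      ∑ i ∈ Finset.Icc 1 M, ∑ j ∈ Finset.Icc 1 M,
        u i * (∫ t in (y r)..(y (r + 1)), (ψ r i * ψ r j).eval t) * u j := by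
    intro r
    have e : ∀ t, ((∑ i ∈ Finset.Icc 1 M, C (u i) * ψ r i).eval t) ^ 2 =
        ∑ i ∈ Finset.Icc 1 M, ∑ j ∈ Finset.Icc 1 M, (C (u i * u j) * (ψ r i * ψ r j)).eval t := by
      intro t
      rw [sq, eval_finsetSum, Finset.sum_mul_sum]
      refine Finset.sum_congr rfl fun i _ => Finset.sum_congr rfl fun j _ => ?_
      simp only [eval_mul, eval_C]; ring
    simp_rw [e]
    rw [intervalIntegral.integral_finsetSum]
    · refine Finset.sum_congr rfl fun i _ => ?_
      rw [intervalIntegral.integral_finsetSum fun j _ => hI _ _ _]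
      refine Finset.sum_congr rfl fun j _ => ?_
      simp_rw [eval_mul (p := C _), eval_C]
      rw [intervalIntegral.integral_const_mul]
      ring
    · intro i _
      refine Continuous.intervalIntegrable ?_ _ _
      exact continuous_finsetSum _ fun j _ => Polynomial.continuous _
  simp_rw [h]
  rw [Finset.sum_comm]
  simp_rw [Finset.mul_sum, Finset.sum_mul]
  conv_rhs => rw [Finset.sum_comm]
  rw [Finset.sum_comm]
  refine Finset.sum_congr rfl fun i _ => ?_
  rw [Finset.sum_comm]


/-- Theorem: L²-Sobolev representation for discrete splines.
For `k = 2m−1`, there is a symmetric positive semidefinite matrix `V^m_n` depending only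
on the design points, banded of bandwidth `2m−1` (entries vanish when `|i−j| ≥ m`), such
that for every `f ∈ H^k_n`,
`∫_a^b (D^m f)(x)² dx = (D^m_n f(x_{1:n}))ᵀ V^m_n (D^m_n f(x_{1:n}))`, where
`(D^m_n f(x_{1:n}))_i = m!·f[x_i,…,x_{i+m}]`. -/
theorem sobolev_representation
    (n m : ℕ) (a b : ℝ) (x : ℕ → ℝ)
    (hm : 1 ≤ m) (hn : 2 * m + 1 ≤ n)
    (hmono : ∀ i, 1 ≤ i → i < n → x i < x (i + 1))
    (ha : a ≤ x 1) (hb : x n ≤ b) (hab : x (n + 1) = b) :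
    ∃ V : ℕ → ℕ → ℝ,
      (∀ i j, V i j = V j i) ∧
      (∀ i j, (i + m ≤ j ∨ j + m ≤ i) → V i j = 0) ∧
      (∀ u : ℕ → ℝ,
        0 ≤ ∑ i ∈ Finset.Icc 1 (n - m), ∑ j ∈ Finset.Icc 1 (n - m), u i * V i j * u j) ∧
      (∀ f : ℝ → ℝ, inFFSpan x n (2 * m - 1) a b f →
        (∫ t in a..b, (Dk m f t) ^ 2) =
          ∑ i ∈ Finset.Icc 1 (n - m), ∑ j ∈ Finset.Icc 1 (n - m),
            ((Nat.factorial m : ℝ) * divDiffVec x (fun ℓ => f (x ℓ)) i m) * V i j *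
              ((Nat.factorial m : ℝ) * divDiffVec x (fun ℓ => f (x ℓ)) j m)) := by
  classical
  have hx : ∀ i j, 1 ≤ i → i < j → j ≤ n → x i < x j := by
    intro i j h1 h2 h3
    induction j, h2 using Nat.le_induction with
    | base => exact hmono i h1 (by omega)
    | succ j hj ih => exact (ih (by omega)).trans (hmono j (by omega) (by omega))
  have hx' : ∀ i j, 1 ≤ i → i ≤ j → j ≤ n → x i ≤ x j := by
    intro i j h1 h2 h3
    rcases Nat.eq_or_lt_of_le h2 with h | h
    · rw [h]
    · exact (hx i j h1 h h3).le
  obtain ⟨k, hk⟩ : ∃ k, k = 2 * m - 1 := ⟨_, rfl⟩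
  let y : ℕ → ℝ := fun i => if i ≤ k then a else if i < n then x i else b
  have hyk : y k = a := by simp [y]
  have hyn : y n = b := by
    have : ¬ n ≤ k := by omega
    simp [y, this]
  have hy : ∀ i, k ≤ i → i < n → y i ≤ y (i + 1) := by
    intro i h1 h2
    have e1 : ¬ (i + 1 ≤ k) := by omega
    simp only [y, e1, if_false, h2, if_true]
    split_ifs with h3 h4 h4
    · exact ha.trans (hx' _ _ le_rfl (by omega) (by omega))
    · exact ha.trans ((hx' 1 n le_rfl (by omega) le_rfl).trans hb)
    · exact (hmono i (by omega) h2).le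
    · exact (hx' i n (by omega) (by omega) le_rfl).trans hb
  have hya : ∀ i, a ≤ y i := by
    intro i
    simp only [y]
    split_ifs with h3 h4
    · exact le_rfl
    · exact ha.trans (hx' _ _ le_rfl (by omega) (by omega))
    · exact ha.trans ((hx' 1 n le_rfl (by omega) le_rfl).trans hb)
  have hyb : ∀ i, y i ≤ b := by
    intro i
    simp only [y]
    split_ifs with h3 h4
    · exact ha.trans ((hx' 1 n le_rfl (by omega) le_rfl).trans hb)
    · exact (hx' i n (by omega) (by omega) le_rfl).trans hb
    · exact le_rfl
  have hφ : ∀ r, ∃ φ : ℕ → Polynomial ℝ, k ≤ r → r < n → ∀ p : Polynomial ℝ,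
      p.natDegree ≤ k → Polynomial.derivative^[m] p = ∑ s ∈ Finset.Icc (r + 1 - k) (r + 1 - m),
        Polynomial.C (divDiffVec x (fun l => p.eval (x l)) s m) * φ s := by
    intro r
    by_cases h : k ≤ r ∧ r < n
    · obtain ⟨φ, hφ⟩ := sr_deriv x (r + 1 - k) m (m - 1)
        (fun i j a b c => hx i j (by omega) b (by omega))
      refine ⟨φ, fun _ _ p hp => ?_⟩
      rw [hφ p (by omega), show r + 1 - k + (m - 1) = r + 1 - m by omega]
    · exact ⟨fun _ => 0, fun h1 h2 => absurd ⟨h1, h2⟩ h⟩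
  choose φ hφ using hφ
  let ψ : ℕ → ℕ → Polynomial ℝ := fun r s =>
    if r + 1 - k ≤ s ∧ s ≤ r + 1 - m then Polynomial.C ((m.factorial : ℝ)⁻¹) * φ r s else 0
  refine ⟨fun i j => ∑ r ∈ Finset.Ico k n, ∫ t in (y r)..(y (r + 1)), (ψ r i * ψ r j).eval t,
    ?_, ?_, ?_, ?_⟩
  · intro i j
    simp_rw [mul_comm (ψ _ i)]
  · intro i j hij
    refine Finset.sum_eq_zero fun r hr => ?_
    rw [Finset.mem_Ico] at hr
    have : ψ r i * ψ r j = 0 := by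
      by_cases h1 : r + 1 - k ≤ i ∧ i ≤ r + 1 - m
      · have h2 : ¬ (r + 1 - k ≤ j ∧ j ≤ r + 1 - m) := by omega
        simp only [ψ, if_neg h2, mul_zero]
      · simp only [ψ, if_neg h1, zero_mul]
    simp [this]
  · intro u
    rw [sr_qf]
    refine Finset.sum_nonneg fun r hr => ?_
    rw [Finset.mem_Ico] at hr
    exact intervalIntegral.integral_nonneg (hy r hr.1 hr.2) fun t _ => sq_nonneg _
  · intro f hf
    rw [← hk] at hf
    obtain ⟨c, hc⟩ := hf
    rw [sr_qf k n (n - m) y ψ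
      (fun i => (m.factorial : ℝ) * divDiffVec x (fun ℓ => f (x ℓ)) i m)]
    let P : ℕ → Polynomial ℝ := fun r =>
      ∑ j ∈ Finset.Icc 1 n, if j ≤ r + 1 then Polynomial.C (c j) * srH x k j else 0
    have hPd : ∀ r, (P r).natDegree ≤ k := by
      intro r
      refine Polynomial.natDegree_sum_le_of_forall_le _ _ fun j _ => ?_
      split_ifs
      · exact (Polynomial.natDegree_C_mul_le _ _).trans (srH_deg _ _ _)
      · simp
    have hPt : ∀ r, k ≤ r → r < n → ∀ t ∈ Set.Ioc (y r) (y (r + 1)), f t = (P r).eval t := by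
      intro r h1 h2 t ht
      rw [hc t ⟨(hya r).trans ht.1.le, ht.2.trans (hyb _)⟩, Polynomial.eval_finsetSum]
      refine Finset.sum_congr rfl fun j hj => ?_
      rw [Finset.mem_Icc] at hj
      rw [srH_eval]
      by_cases h3 : j ≤ r + 1
      · rw [if_pos h3, Polynomial.eval_mul, Polynomial.eval_C, if_neg]
        rintro ⟨h4, h5⟩
        have e1 : ¬ r ≤ k := by omega
        have := ht.1
        simp only [y, e1, h2, if_true, if_false] at this
        exact absurd (hx' (j - 1) r (by omega) (by omega) (by omega)) (by linarith)
      · rw [if_neg h3, if_pos, mul_zero, Polynomial.eval_zero]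
        refine ⟨by omega, ?_⟩
        have e1 : ¬ r + 1 ≤ k := by omega
        have e2 : r + 1 < n := by omega
        have := ht.2
        simp only [y, e1, e2, if_true, if_false] at this
        exact this.trans (hx' _ _ (by omega) (by omega) (by omega))
    have hPx : ∀ r, k ≤ r → r < n → ∀ l, r + 1 - k ≤ l → l ≤ r + 1 →
        f (x l) = (P r).eval (x l) := by
      intro r h1 h2 l h3 h4
      rw [hc (x l) ⟨ha.trans (hx' _ _ le_rfl (by omega) (by omega)),
        (hx' l n (by omega) (by omega) le_rfl).trans hb⟩, Polynomial.eval_finsetSum]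
      refine Finset.sum_congr rfl fun j hj => ?_
      rw [Finset.mem_Icc] at hj
      rw [srH_eval]
      by_cases h5 : j ≤ r + 1
      · rw [if_pos h5, Polynomial.eval_mul, Polynomial.eval_C]
        split_ifs with h6
        · have h7 : l ≤ j - 1 := by
            by_contra h8
            exact absurd (hx (j - 1) l (by omega) (by omega) (by omega)) (not_lt.2 h6.2)
          rw [srH_zero x k j l h6.1 (by omega) h7]
        · rfl
      · rw [if_neg h5, if_pos, mul_zero, Polynomial.eval_zero]
        exact ⟨by omega, hx' _ _ (by omega) (by omega) (by omega)⟩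
    have hm0 : (m.factorial : ℝ) ≠ 0 := Nat.cast_ne_zero.2 m.factorial_ne_zero
    have hder : ∀ r, k ≤ r → r < n → Polynomial.derivative^[m] (P r) =
        ∑ i ∈ Finset.Icc 1 (n - m),
          Polynomial.C ((m.factorial : ℝ) * divDiffVec x (fun ℓ => f (x ℓ)) i m) * ψ r i := by
      intro r h1 h2
      rw [hφ r h1 h2 (P r) (hPd r)]
      simp only [ψ, mul_ite, mul_zero]
      rw [← Finset.sum_filter]
      refine Finset.sum_congr ?_ fun s hs => ?_
      · ext s; simp only [Finset.mem_Icc, Finset.mem_filter]; omega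
      · simp only [Finset.mem_Icc, Finset.mem_filter] at hs
        rw [sr_dd_congr x (fun l => (P r).eval (x l)) (fun l => f (x l)) m s
          (fun l a b => (hPx r h1 h2 l (by omega) (by omega)).symm), ← mul_assoc,
          ← Polynomial.C_mul]
        congr 2
        field_simp
    have hEq : ∀ r, k ≤ r → r < n → Set.EqOn (fun t => (Dk m f t) ^ 2)
        (fun t => ((∑ i ∈ Finset.Icc 1 (n - m),
          Polynomial.C ((m.factorial : ℝ) * divDiffVec x (fun ℓ => f (x ℓ)) i m) *
            ψ r i).eval t) ^ 2) (Set.uIoc (y r) (y (r + 1))) := by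
      intro r h1 h2 t ht
      rw [Set.uIoc_of_le (hy r h1 h2)] at ht
      simp only
      rw [sr_Dk m _ _ f (P r) (hPt r h1 h2) t ht, hder r h1 h2]
    rw [← hyk, ← hyn, ← intervalIntegral.sum_integral_adjacent_intervals_Ico (by omega)]
    · refine Finset.sum_congr rfl fun r hr => ?_
      rw [Finset.mem_Ico] at hr
      exact intervalIntegral.integral_congr_ae
        (Filter.Eventually.of_forall fun t ht => hEq r hr.1 hr.2 ht)
    · intro r hr
      rw [Set.mem_Ico] at hr
      rw [intervalIntegrable_congr (hEq r hr.1 hr.2)]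
      exact ((Polynomial.continuous _).pow 2).intervalIntegrable _ _
end

section
/- Proximity of the truncated power basis and falling factorial basis: let k ≥ 2, n ≥ k+2, and δ_n = max_{i=1,…,n−1}(x_{i+1} − x_i). Let g^k_j(x) = (1/k!)·(x − x_{j−1})₊^k for j = k+2,…,n (with t₊ = max{t,0}) be the truncated power basis functions with knots x_{(k+1):(n−1)}. Then: (i) for each j = k+2,…,n, sup_{x∈[a,b]} |g^k_j(x) − h^k_j(x)| ≤ (k(b−a)^{k−1}/(k−1)!)·δ_n; and (ii) for every spline g in the span of {x^{j−1}/(j−1)! : j = 1,…,k+1} ∪ {g^k_j : j = k+2,…,n}, there exists h ∈ H^k_n with TV(D^k h) = TV(D^k g) and sup_{x∈[a,b]} |g(x) − h(x)| ≤ (k(b−a)^{k−1}/(k−1)!)·δ_n·TV(D^k g). -/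
open Finset

/-- The `k`-th degree truncated power basis function `g^k_j` with knots
`x_{(k+1):(n−1)}`: `g^k_j(t) = t^{j−1}/(j−1)!` for `j ≤ k+1`, and
`g^k_j(t) = (t − x_{j−1})₊^k / k!` for `j ≥ k+2`. -/
noncomputable def truncPow (x : ℕ → ℝ) (k j : ℕ) (t : ℝ) : ℝ :=
  if j ≤ k + 1 then t ^ (j - 1) / (Nat.factorial (j - 1) : ℝ)
  else (1 / (Nat.factorial k : ℝ)) * (max (t - x (j - 1)) 0) ^ k

open Polynomial in
theorem aux_Dk_poly (m : ℕ) : ∀ (f : ℝ → ℝ) (p : ℝ[X]) (s t : ℝ), s < t →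
    (∀ u ∈ Set.Ioc s t, f u = p.eval u) → Dk m f t = (derivative^[m] p).eval t := by
  induction m with
  | zero => intro f p s t hst h; simpa [Dk] using h t ⟨hst, le_rfl⟩
  | succ m ih =>
    intro f p s t hst h
    have := ih (lDeriv f) (derivative p) s t hst (by
      intro u hu
      have h1 : f =ᶠ[nhdsWithin u (Set.Iic u)] fun v => p.eval v := by
        have : Set.Ioc s u ∈ nhdsWithin u (Set.Iic u) := Ioc_mem_nhdsLE hu.1
        filter_upwards [this] with v hv
        exact h v ⟨hv.1, hv.2.trans hu.2⟩
      unfold lDeriv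
      rw [h1.derivWithin_eq (h u hu)]
      exact (p.hasDerivAt u).hasDerivWithinAt.derivWithin (uniqueDiffWithinAt_Iic u))
    simpa [Dk] using this

theorem aux_Dk_congr (m : ℕ) : ∀ (f g : ℝ → ℝ) (t : ℝ), (∀ u ≤ t, f u = g u) →
    Dk m f t = Dk m g t := by
  induction m with
  | zero => intro f g t h; simpa [Dk] using h t le_rfl
  | succ m ih =>
    intro f g t h
    have := ih (lDeriv f) (lDeriv g) t (by
      intro u hu
      unfold lDeriv
      exact derivWithin_congr (fun v hv => h v (le_trans hv hu)) (h u hu))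
    simpa [Dk] using this

open Polynomial in
theorem aux_iter_monic (p : ℝ[X]) (k : ℕ) (hp : p.Monic) (hd : p.natDegree = k) (t : ℝ) :
    (derivative^[k] p).eval t = (Nat.factorial k : ℝ) := by
  have h0 : (derivative^[k] p).natDegree = 0 := by
    have := natDegree_iterate_derivative p k
    omega
  rw [eq_C_of_natDegree_eq_zero h0, eval_C, coeff_iterate_derivative]
  have : p.coeff k = 1 := by rw [← hd]; exact hp
  simp [this, Nat.descFactorial_self]

/-- value of the k-th derivative of the j-th basis function -/
noncomputable def auxE (x : ℕ → ℝ) (k j : ℕ) (t : ℝ) : ℝ :=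
  if j ≤ k then 0 else if j = k + 1 then 1 else if x (j - 1) < t then 1 else 0

/-- mixed basis -/
noncomputable def auxM (x : ℕ → ℝ) (k j : ℕ) (t : ℝ) : ℝ :=
  if j ≤ k + 1 then truncPow x k j t else fallFact x k j t

open Polynomial in
theorem aux_poly_low (x : ℕ → ℝ) (k j : ℕ) (hj1 : 1 ≤ j) (hj : j ≤ k + 1) (t : ℝ) :
    ∃ p : ℝ[X], (∀ u, truncPow x k j u = p.eval u) ∧ (derivative^[k] p).eval t = auxE x k j t := by
  refine ⟨C (1 / (Nat.factorial (j - 1) : ℝ)) * X ^ (j - 1), ?_, ?_⟩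
  · intro u; simp [truncPow, hj]; ring
  · rw [iterate_derivative_C_mul]
    by_cases h : j ≤ k
    · rw [iterate_derivative_eq_zero (by simp; omega)]
      simp [auxE, h]
    · have : j = k + 1 := by omega
      subst this
      simp only [Nat.add_sub_cancel]
      rw [eval_mul, aux_iter_monic (X ^ k) k (monic_X_pow k) (by simp)]
      simp [auxE, Nat.factorial_ne_zero]

open Polynomial in
theorem aux_poly_trunc (x : ℕ → ℝ) (k j : ℕ) (hk : 2 ≤ k) (hj1 : 1 ≤ j) (s t : ℝ)
    (hs : x (j - 1) < t → x (j - 1) ≤ s) :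
    ∃ p : ℝ[X], (∀ u ∈ Set.Ioc s t, truncPow x k j u = p.eval u) ∧
      (derivative^[k] p).eval t = auxE x k j t := by
  by_cases hj : j ≤ k + 1
  · obtain ⟨p, h1, h2⟩ := aux_poly_low x k j hj1 hj t
    exact ⟨p, fun u _ => h1 u, h2⟩
  have e1 : ¬ j ≤ k := by omega
  have e2 : ¬ j = k + 1 := by omega
  by_cases hx : x (j - 1) < t
  · refine ⟨C (1 / (Nat.factorial k : ℝ)) * (X - C (x (j-1))) ^ k, ?_, ?_⟩
    · intro u hu
      have := hs hx
      simp [truncPow, hj, max_eq_left (sub_nonneg.2 (this.trans hu.1.le))]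
    · rw [iterate_derivative_C_mul, eval_mul,
        aux_iter_monic _ k ((monic_X_sub_C _).pow k) (by simp)]
      simp [auxE, e1, e2, hx, Nat.factorial_ne_zero]
  · refine ⟨0, ?_, ?_⟩
    · intro u hu
      have : u - x (j - 1) ≤ 0 := by linarith [hu.2]
      simp [truncPow, hj, max_eq_right this]
      right; omega
    · simp [auxE, e1, e2, hx]

open Polynomial in
theorem aux_poly_mix (x : ℕ → ℝ) (k j : ℕ) (hj1 : 1 ≤ j) (s t : ℝ)
    (hs : x (j - 1) < t → x (j - 1) ≤ s) :
    ∃ p : ℝ[X], (∀ u ∈ Set.Ioc s t, auxM x k j u = p.eval u) ∧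
      (derivative^[k] p).eval t = auxE x k j t := by
  by_cases hj : j ≤ k + 1
  · obtain ⟨p, h1, h2⟩ := aux_poly_low x k j hj1 hj t
    exact ⟨p, fun u _ => by simp [auxM, hj, h1], h2⟩
  have e1 : ¬ j ≤ k := by omega
  have e2 : ¬ j = k + 1 := by omega
  by_cases hx : x (j - 1) < t
  · refine ⟨C (1 / (Nat.factorial k : ℝ)) * ∏ l ∈ Finset.Icc (j - k) (j - 1), (X - C (x l)), ?_, ?_⟩
    · intro u hu
      have := (hs hx).trans_lt hu.1
      simp [auxM, fallFact, hj, this, eval_prod]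
    · rw [iterate_derivative_C_mul, eval_mul,
        aux_iter_monic _ k (monic_prod_X_sub_C _ _) (by
          rw [natDegree_finset_prod_X_sub_C_eq_card]; simp; omega)]
      simp [auxE, e1, e2, hx, Nat.factorial_ne_zero]
  · refine ⟨0, ?_, ?_⟩
    · intro u hu
      have : ¬ x (j - 1) < u := by linarith [hu.2]
      simp [auxM, fallFact, hj, this]
    · simp [auxE, e1, e2, hx]

theorem aux_exists_s (x : ℕ → ℝ) (n : ℕ) (a t : ℝ) (h : a < t) :
    ∃ s, a ≤ s ∧ s < t ∧ ∀ i ≤ n, x i < t → x i ≤ s := by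
  induction n with
  | zero =>
    by_cases h0 : x 0 < t
    · exact ⟨max a (x 0), le_max_left _ _, max_lt h h0, fun i hi _ => by
        have : i = 0 := by omega
        subst this; exact le_max_right _ _⟩
    · exact ⟨a, le_rfl, h, fun i hi h1 => by
        have : i = 0 := by omega
        subst this; exact absurd h1 h0⟩
  | succ n ih =>
    obtain ⟨s, h1, h2, h3⟩ := ih
    by_cases h0 : x (n+1) < t
    · refine ⟨max s (x (n+1)), h1.trans (le_max_left _ _), max_lt h2 h0, fun i hi hx => ?_⟩
      rcases Nat.lt_or_ge i (n+1) with h4 | h4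
      · exact (h3 i (by omega) hx).trans (le_max_left _ _)
      · have : i = n+1 := by omega
        subst this; exact le_max_right _ _
    · refine ⟨s, h1, h2, fun i hi hx => ?_⟩
      rcases Nat.lt_or_ge i (n+1) with h4 | h4
      · exact h3 i (by omega) hx
      · have : i = n+1 := by omega
        subst this; exact absurd hx h0

open Polynomial in
theorem aux_Dk_sum (n k : ℕ) (F : ℕ → ℝ → ℝ) (x : ℕ → ℝ) (c : ℕ → ℝ) (g : ℝ → ℝ) (a b : ℝ)
    (hg : ∀ t ∈ Set.Icc a b, g t = ∑ j ∈ Finset.Icc 1 n, c j * F j t)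
    (hF : ∀ j, 1 ≤ j → ∀ s t, (x (j - 1) < t → x (j - 1) ≤ s) →
      ∃ p : ℝ[X], (∀ u ∈ Set.Ioc s t, F j u = p.eval u) ∧
      (derivative^[k] p).eval t = auxE x k j t) (t : ℝ) (ht : t ∈ Set.Ioc a b) :
    Dk k g t = ∑ j ∈ Finset.Icc 1 n, c j * auxE x k j t := by
  obtain ⟨s, h1, h2, h3⟩ := aux_exists_s x n a t ht.1
  have : ∀ j, ∃ p : ℝ[X], j ∈ Finset.Icc 1 n → (∀ u ∈ Set.Ioc s t, F j u = p.eval u) ∧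
      (derivative^[k] p).eval t = auxE x k j t := by
    intro j
    by_cases hj : j ∈ Finset.Icc 1 n
    · have hj' := Finset.mem_Icc.1 hj
      obtain ⟨p, hp⟩ := hF j hj'.1 s t (h3 (j-1) (by omega))
      exact ⟨p, fun _ => hp⟩
    · exact ⟨0, fun h => absurd h hj⟩
  choose p hp using this
  rw [aux_Dk_poly k g (∑ j ∈ Finset.Icc 1 n, C (c j) * p j) s t h2]
  · rw [iterate_derivative_sum, eval_finset_sum]
    refine Finset.sum_congr rfl fun j hj => ?_
    rw [iterate_derivative_C_mul, eval_mul, eval_C, (hp j hj).2]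
  · intro u hu
    rw [hg u ⟨h1.trans hu.1.le, hu.2.trans ht.2⟩, eval_finset_sum]
    refine Finset.sum_congr rfl fun j hj => ?_
    rw [eval_mul, eval_C, (hp j hj).1 u hu]

theorem aux_pow_span (x : ℕ → ℝ) (m : ℕ) : ∀ N, m < N → ∃ d : ℕ → ℝ, ∀ t : ℝ,
    t ^ m = ∑ i ∈ Finset.range N, d i * ∏ l ∈ Finset.Icc 1 i, (t - x l) := by
  induction m with
  | zero =>
    intro N hN
    refine ⟨fun i => if i = 0 then 1 else 0, fun t => ?_⟩
    simp [hN]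
  | succ m ih =>
    intro N hN
    obtain ⟨M, rfl⟩ : ∃ M, N = M + 1 := ⟨N - 1, by omega⟩
    obtain ⟨d, hd⟩ := ih M (by omega)
    refine ⟨fun i => (if i = 0 then 0 else d (i - 1)) + (if i < M then x (i+1) * d i else 0),
      fun t => ?_⟩
    simp only [add_mul, Finset.sum_add_distrib]
    rw [Finset.sum_range_succ', Finset.sum_range_succ (fun i => (if i < M then x (i+1) * d i else 0) * _)]
    simp only [lt_irrefl, if_true, if_false, zero_mul, add_zero, Nat.add_sub_cancel,
      Nat.add_eq_zero_iff, one_ne_zero, and_false]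
    rw [← Finset.sum_add_distrib, pow_succ, hd t, Finset.sum_mul]
    refine Finset.sum_congr rfl fun i hi => ?_
    rw [if_pos (Finset.mem_range.1 hi), Finset.prod_Icc_succ_top (by omega)]
    ring

theorem aux_low_span (x : ℕ → ℝ) (k j : ℕ) (hj1 : 1 ≤ j) (hj : j ≤ k + 1) :
    ∃ d : ℕ → ℝ, ∀ t : ℝ,
    truncPow x k j t = ∑ i ∈ Finset.Icc 1 (k+1), d i * fallFact x k i t := by
  obtain ⟨d, hd⟩ := aux_pow_span x (j - 1) (k + 1) (by omega)
  refine ⟨fun i => d (i - 1) * (Nat.factorial (i - 1) : ℝ) / (Nat.factorial (j - 1) : ℝ), fun t => ?_⟩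
  have : Finset.Icc 1 (k+1) = Finset.Ico 1 (k+2) := by ext; simp; omega
  rw [this, Finset.sum_Ico_eq_sum_range]
  simp only [truncPow, hj, if_true]
  rw [hd t, Finset.sum_div]
  refine Finset.sum_congr rfl fun i hi => ?_
  have hi' : i < k + 1 := by simpa using hi
  have h2 : 1 + i ≤ k + 1 := by omega
  have h3 : (Nat.factorial i : ℝ) ≠ 0 := by exact_mod_cast Nat.factorial_ne_zero i
  simp only [fallFact, h2, if_true, Nat.add_sub_cancel_left]
  field_simp

theorem aux_prod_diff (s : Finset ℕ) (f : ℕ → ℝ) (y M e : ℝ) (hM : 0 ≤ M) (hy0 : 0 ≤ y) (hy : y ≤ M)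
    (hf : ∀ i ∈ s, 0 ≤ f i ∧ f i ≤ M ∧ |f i - y| ≤ e) :
    M * |∏ i ∈ s, f i - y ^ s.card| ≤ s.card * e * M ^ s.card := by
  induction s using Finset.induction_on with
  | empty => simp
  | insert i s hi ih =>
    have ih := ih (fun j hj => hf j (Finset.mem_insert_of_mem hj))
    obtain ⟨h1, h2, h3⟩ := hf i (Finset.mem_insert_self _ _)
    have he : 0 ≤ e := (abs_nonneg _).trans h3
    rw [Finset.prod_insert hi, Finset.card_insert_of_notMem hi]
    have e1 : f i * ∏ j ∈ s, f j - y ^ (s.card + 1) =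
      f i * (∏ j ∈ s, f j - y ^ s.card) + (f i - y) * y ^ s.card := by ring
    have hp : y ^ s.card ≤ M ^ s.card := pow_le_pow_left₀ hy0 hy _
    have hp0 : 0 ≤ y ^ s.card := pow_nonneg hy0 _
    calc M * |f i * ∏ j ∈ s, f j - y ^ (s.card + 1)|
        ≤ M * (f i * |∏ j ∈ s, f j - y ^ s.card| + |f i - y| * y ^ s.card) := by
          rw [e1]
          refine mul_le_mul_of_nonneg_left ((abs_add_le _ _).trans ?_) hM
          rw [abs_mul, abs_mul, abs_of_nonneg h1, abs_of_nonneg hp0]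
      _ = f i * (M * |∏ j ∈ s, f j - y ^ s.card|) + M * (|f i - y| * y ^ s.card) := by ring
      _ ≤ M * (s.card * e * M ^ s.card) + M * (e * M ^ s.card) := by
          gcongr
      _ = _ := by push_cast; ring

theorem aux_part1
    (n k : ℕ) (a b : ℝ) (x : ℕ → ℝ)
    (hk : 2 ≤ k) 
    (hmono : ∀ i, 1 ≤ i → i < n → x i < x (i + 1))
    (hm : ∀ i j, 1 ≤ i → i ≤ j → j ≤ n → x i ≤ x j)
    (ha : a ≤ x 1) (hb : x n ≤ b) 
    (δ : ℝ)  (hδ0 : 0 ≤ δ)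
    (hδ : ∀ i, 1 ≤ i → i < n → x (i + 1) - x i ≤ δ) :
    (∀ j ∈ Finset.Icc (k + 2) n, ∀ t ∈ Set.Icc a b,
      |truncPow x k j t - fallFact x k j t| ≤
        ((k : ℝ) * (b - a) ^ (k - 1) / (Nat.factorial (k - 1) : ℝ)) * δ) := by
  intro j hj t ht
  obtain ⟨hj1, hj2⟩ := Finset.mem_Icc.1 hj
  have hnj : ¬ j ≤ k + 1 := by omega
  have hba : 0 ≤ b - a := by linarith [ht.1, ht.2]
  simp only [truncPow, fallFact, hnj, if_false]
  by_cases hx : x (j - 1) < t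
  · have hlt : 0 < b - a := by
      have := hm 1 (j-1) le_rfl (by omega) (by omega)
      linarith [ht.2]
    rw [max_eq_left (by linarith), if_pos hx, mul_one, ← mul_sub, abs_mul, abs_sub_comm]
    have hd : ∀ d i, 1 ≤ i → i + d ≤ n → x (i + d) - x i ≤ d * δ := by
      intro d
      induction d with
      | zero => intro i _ _; simp
      | succ d ih =>
        intro i h1 h2
        have := ih i h1 (by omega)
        have := hδ (i + d) (by omega) (by omega)
        push_cast
        rw [← add_assoc]
        linarith
    have hcard : (Finset.Icc (j-k) (j-1)).card = k := by simp; omega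
    have key := aux_prod_diff (Finset.Icc (j-k) (j-1)) (fun l => t - x l) (t - x (j-1)) (b - a) (k * δ)
      hba (by linarith) (by
        have := hm 1 (j-1) le_rfl (by omega) (by omega)
        linarith [ht.2]) (by
        intro l hl
        obtain ⟨h1, h2⟩ := Finset.mem_Icc.1 hl
        have a1 := hm l (j-1) (by omega) h2 (by omega)
        have a2 := hm 1 l le_rfl (by omega) (by omega)
        refine ⟨by linarith, by linarith [ht.2], ?_⟩
        have e : t - x l - (t - x (j-1)) = x (j-1) - x l := by ring
        rw [e, abs_of_nonneg (by linarith)]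
        have := hd (j - 1 - l) l (by omega) (by omega)
        rw [show l + (j - 1 - l) = j - 1 by omega] at this
        refine this.trans ?_
        gcongr
        omega)
    rw [hcard] at key
    obtain ⟨q, rfl⟩ : ∃ q, k = q + 1 := ⟨k - 1, by omega⟩
    have key2 : |∏ i ∈ Finset.Icc (j-(q+1)) (j-1), (t - x i) - (t - x (j-1)) ^ (q+1)| ≤
      ((q+1 : ℕ):ℝ) * (((q+1:ℕ):ℝ) * δ) * (b-a)^q := by
      refine le_of_mul_le_mul_left (key.trans (le_of_eq ?_)) hlt
      ring
    have hf : (0:ℝ) < Nat.factorial q := by exact_mod_cast Nat.factorial_pos q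
    rw [abs_of_nonneg (by positivity)]
    refine (mul_le_mul_of_nonneg_left key2 (by positivity)).trans (le_of_eq ?_)
    rw [Nat.factorial_succ, Nat.add_sub_cancel]
    have : ((q + 1 : ℕ) : ℝ) ≠ 0 := by positivity
    rw [Nat.cast_mul]
    field_simp
  · rw [max_eq_right (by linarith), if_neg hx, zero_pow (by omega)]
    simp
    positivity

theorem aux_tv_lower (n k : ℕ) (a b : ℝ) (x : ℕ → ℝ) (c : ℕ → ℝ) (G : ℝ → ℝ)
    (hm : ∀ i j, 1 ≤ i → i < j → j ≤ n → x i < x j)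
    (ha : a ≤ x 1) (hb : x n ≤ b) (hk : 2 ≤ k)
    (hG : ∀ t ∈ Set.Ioc a b, G t = ∑ j ∈ Finset.Icc 1 n, c j * auxE x k j t) :
    ENNReal.ofReal (∑ j ∈ Finset.Icc (k+2) n, |c j|) ≤ eVariationOn G (Set.Icc a b) := by
  have hmem : ∀ i, k + 1 ≤ i → i ≤ n → x i ∈ Set.Ioc a b := by
    intro i h1 h2
    refine ⟨ha.trans_lt (hm 1 i le_rfl (by omega) h2), ?_⟩
    rcases Nat.lt_or_ge i n with h | h
    · exact (hm i n (by omega) h le_rfl).le.trans hb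
    · rw [show i = n by omega]; exact hb
  have hmon : MonotoneOn x (Set.Icc (k+1) n) := by
    intro i hi j hj hij
    rcases Nat.lt_or_ge i j with h | h
    · exact (hm i j (by have := hi.1; omega) h hj.2).le
    · rw [show i = j by omega]
  have h1 := eVariationOn.sum_le_of_monotoneOn_Icc (f := G) (s := Set.Icc a b) hmon
    (fun i hi => Set.Ioc_subset_Icc_self (hmem i hi.1 hi.2))
  refine le_trans (le_of_eq ?_) h1
  rw [ENNReal.ofReal_sum_of_nonneg (fun _ _ => abs_nonneg _)]
  have : Finset.Icc (k+2) n = Finset.Ico (k+1+1) (n+1) := by ext; simp; omega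
  rw [this, ← Finset.sum_Ico_add' _ (k+1) n 1]
  refine Finset.sum_congr rfl fun i hi => ?_
  obtain ⟨hi1, hi2⟩ := Finset.mem_Ico.1 hi
  rw [edist_dist, Real.dist_eq, hG _ (hmem (i+1) (by omega) (by omega)),
    hG _ (hmem i (by omega) (by omega)), ← Finset.sum_sub_distrib,
    Finset.sum_eq_single (i+1)]
  · have e1 : ¬ i + 1 ≤ k := by omega
    have e2 : ¬ i = k := by omega
    simp [auxE, e1, e2, hm i (i+1) (by omega) (by omega) (by omega)]
  · intro j hj hne
    obtain ⟨hj1, hj2⟩ := Finset.mem_Icc.1 hj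
    unfold auxE
    split_ifs with q1 q2 q3 q4 q4
    · simp
    · simp
    · simp
    · exfalso
      apply q4
      refine lt_of_not_ge fun hge => ?_
      rcases Nat.lt_or_ge (j-1) i with h | h
      · exact absurd (hm (j-1) i (by omega) h (by omega)) (not_lt.2 hge)
      · rcases Nat.lt_or_ge (i+1) (j-1) with h' | h'
        · exact absurd (hm (i+1) (j-1) (by omega) h' (by omega)) (not_lt.2 q3.le)
        · have : j - 1 = i + 1 := by omega
          rw [this] at q3; exact lt_irrefl _ q3
    · exact absurd (q4.trans (hm i (i+1) (by omega) (by omega) (by omega))) q3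
    · simp
  · intro h; exfalso; apply h; simp; omega

/-- Lemma: proximity of the truncated power and falling factorial
bases.  For `k ≥ 2` and `δ_n = max_i (x_{i+1} − x_i)`:
(i) `‖g^k_j − h^k_j‖_∞ ≤ k(b−a)^{k−1}/(k−1)!·δ_n` for `j = k+2,…,n`; and
(ii) every spline `g` in the span of the truncated power basis admits `h ∈ H^k_n` with
`TV(D^k h) = TV(D^k g)` and `‖g − h‖_∞ ≤ k(b−a)^{k−1}/(k−1)!·δ_n·TV(D^k g)`. -/
theorem truncPow_fallFact_proximity
    (n k : ℕ) (a b : ℝ) (x : ℕ → ℝ)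
    (hk : 2 ≤ k) (hn : k + 2 ≤ n)
    (hmono : ∀ i, 1 ≤ i → i < n → x i < x (i + 1))
    (ha : a ≤ x 1) (hb : x n ≤ b) (hab : x (n + 1) = b)
    (δ : ℝ)
    (hδ : δ = (Finset.Icc 1 (n - 1)).sup' (Finset.nonempty_Icc.mpr (by omega))
      (fun i => x (i + 1) - x i)) :
    (∀ j ∈ Finset.Icc (k + 2) n, ∀ t ∈ Set.Icc a b,
      |truncPow x k j t - fallFact x k j t| ≤
        ((k : ℝ) * (b - a) ^ (k - 1) / (Nat.factorial (k - 1) : ℝ)) * δ) ∧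
    (∀ g : ℝ → ℝ,
      (∃ c : ℕ → ℝ, ∀ t ∈ Set.Icc a b, g t = ∑ j ∈ Finset.Icc 1 n, c j * truncPow x k j t) →
      ∃ h : ℝ → ℝ, inFFSpan x n k a b h ∧
        eVariationOn (Dk k h) (Set.Icc a b) = eVariationOn (Dk k g) (Set.Icc a b) ∧
        ∀ t ∈ Set.Icc a b,
          ENNReal.ofReal |g t - h t| ≤
            ENNReal.ofReal (((k : ℝ) * (b - a) ^ (k - 1) / (Nat.factorial (k - 1) : ℝ)) * δ) *
              eVariationOn (Dk k g) (Set.Icc a b)) := by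
  have hm : ∀ i j, 1 ≤ i → i < j → j ≤ n → x i < x j := by
    intro i j h1 h2
    induction j, h2 using Nat.le_induction with
    | base => intro h; exact hmono i h1 (by omega)
    | succ j hj ih => intro h; exact (ih (by omega)).trans (hmono j (by omega) (by omega))
  have hm' : ∀ i j, 1 ≤ i → i ≤ j → j ≤ n → x i ≤ x j := by
    intro i j h1 h2 h3
    rcases Nat.lt_or_ge i j with h | h
    · exact (hm i j h1 h h3).le
    · rw [show i = j by omega]
  have hδ1 : ∀ i, 1 ≤ i → i < n → x (i + 1) - x i ≤ δ := by
    intro i h1 h2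
    rw [hδ]
    exact Finset.le_sup' (fun i => x (i + 1) - x i) (Finset.mem_Icc.2 ⟨h1, by omega⟩)
  have hδ0 : 0 ≤ δ := by
    have := hδ1 1 le_rfl (by omega)
    linarith [hmono 1 le_rfl (by omega)]
  have P1 := aux_part1 n k a b x hk hmono hm' ha hb δ hδ0 hδ1
  refine ⟨P1, ?_⟩
  rintro g ⟨c, hc⟩
  have hsplit : ∀ f : ℕ → ℝ, ∑ j ∈ Finset.Icc 1 n, f j =
      ∑ j ∈ Finset.Icc 1 (k+1), f j + ∑ j ∈ Finset.Icc (k+2) n, f j := by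
    intro f
    rw [← Finset.sum_union]
    · congr 1; ext; simp; omega
    · rw [Finset.disjoint_left]; intro i; simp; omega
  set h : ℝ → ℝ := fun t => g t - ∑ j ∈ Finset.Icc (k+2) n,
    c j * (truncPow x k j t - fallFact x k j t) with hh
  have hmix : ∀ t ∈ Set.Icc a b, h t = ∑ j ∈ Finset.Icc 1 n, c j * auxM x k j t := by
    intro t ht
    simp only [hh]
    rw [hc t ht, hsplit, hsplit, add_sub_assoc, ← Finset.sum_sub_distrib]
    congr 1
    · refine Finset.sum_congr rfl fun j hj => ?_
      have : j ≤ k + 1 := (Finset.mem_Icc.1 hj).2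
      simp [auxM, this]
    · refine Finset.sum_congr rfl fun j hj => ?_
      have : ¬ j ≤ k + 1 := by have := (Finset.mem_Icc.1 hj).1; omega
      simp only [auxM, this, if_false]
      ring
  have hDg := aux_Dk_sum n k (truncPow x k) x c g a b hc
    (fun j hj s t hs => aux_poly_trunc x k j hk hj s t hs)
  have hDh := aux_Dk_sum n k (auxM x k) x c h a b hmix
    (fun j hj s t hs => aux_poly_mix x k j hj s t hs)
  refine ⟨h, ?_, ?_, ?_⟩
  · have : ∀ j, ∃ d : ℕ → ℝ, j ∈ Finset.Icc 1 (k+1) → ∀ t : ℝ,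
        truncPow x k j t = ∑ i ∈ Finset.Icc 1 (k+1), d i * fallFact x k i t := by
      intro j
      by_cases hj : j ∈ Finset.Icc 1 (k+1)
      · obtain ⟨d, hd⟩ := aux_low_span x k j (Finset.mem_Icc.1 hj).1 (Finset.mem_Icc.1 hj).2
        exact ⟨d, fun _ => hd⟩
      · exact ⟨0, fun h => absurd h hj⟩
    choose d hd using this
    refine ⟨fun i => if i ≤ k + 1 then ∑ j ∈ Finset.Icc 1 (k+1), c j * d j i else c i, ?_⟩
    intro t ht
    rw [hmix t ht, hsplit, hsplit]
    congr 1
    · have e : ∀ i ∈ Finset.Icc 1 (k+1),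
          (if i ≤ k + 1 then ∑ j ∈ Finset.Icc 1 (k+1), c j * d j i else c i) * fallFact x k i t
          = ∑ j ∈ Finset.Icc 1 (k+1), c j * (d j i * fallFact x k i t) := by
        intro i hi
        rw [if_pos (Finset.mem_Icc.1 hi).2, Finset.sum_mul]
        exact Finset.sum_congr rfl fun j _ => by ring
      rw [Finset.sum_congr rfl e, Finset.sum_comm]
      refine Finset.sum_congr rfl fun j hj => ?_
      have : j ≤ k + 1 := (Finset.mem_Icc.1 hj).2
      simp only [auxM, this, if_true]
      rw [hd j hj t, Finset.mul_sum]
    · refine Finset.sum_congr rfl fun j hj => ?_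
      have : ¬ j ≤ k + 1 := by have := (Finset.mem_Icc.1 hj).1; omega
      simp only [auxM, this, if_false]
  · apply eVariationOn.congr
    intro t ht
    rcases ht.1.eq_or_lt with h0 | h0
    · subst h0
      apply aux_Dk_congr
      intro u hu
      simp only [hh]
      rw [Finset.sum_eq_zero, sub_zero]
      intro j hj
      have hj' := Finset.mem_Icc.1 hj
      have e1 : ¬ j ≤ k + 1 := by omega
      have e2 : u ≤ x (j - 1) := hu.trans (ha.trans (hm' 1 (j-1) le_rfl (by omega) (by omega)))
      simp only [truncPow, fallFact, e1, if_false, not_lt.2 e2]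
      rw [max_eq_right (by linarith), zero_pow (by omega)]
      ring
    · rw [hDg t ⟨h0, ht.2⟩, hDh t ⟨h0, ht.2⟩]
  · intro t ht
    have hlow := aux_tv_lower n k a b x c (Dk k g) hm ha hb hk hDg
    refine le_trans ?_ (mul_le_mul_right hlow _)
    have hba : 0 ≤ b - a := by linarith [ht.1, ht.2]
    rw [← ENNReal.ofReal_mul (by positivity)]
    apply ENNReal.ofReal_le_ofReal
    have : g t - h t = ∑ j ∈ Finset.Icc (k+2) n,
      c j * (truncPow x k j t - fallFact x k j t) := by simp [hh]
    rw [this, Finset.mul_sum]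
    refine (Finset.abs_sum_le_sum_abs _ _).trans (Finset.sum_le_sum fun j hj => ?_)
    rw [abs_mul, mul_comm]
    exact mul_le_mul_of_nonneg_right (P1 j hj t ht) (abs_nonneg _)
end

section
/- Spectral similarity underlying the cubic smoothing spline and weighted Bohlmann–Whittaker filter: let n ≥ 3 and x_1 < x_2 < ⋯ < x_n be real numbers. Define the symmetric tridiagonal matrix A ∈ ℝ^{(n−2)×(n−2)} with A_{ii} = (x_{i+2} − x_i)/3 for i = 1,…,n−2 and A_{i,i+1} = A_{i+1,i} = (x_{i+2} − x_{i+1})/6 for i = 1,…,n−3, and the diagonal matrix W = diag((x_3 − x_1)/2, …, (x_n − x_{n−2})/2) ∈ ℝ^{(n−2)×(n−2)}. Then (1/3)·uᵀWu ≤ uᵀAu ≤ uᵀWu for all u ∈ ℝ^{n−2}. Consequently A is positive definite, and the matrices K²_n := W A⁻¹ W and W are (3,1)-spectrally-similar. -/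
open Matrix


theorem aux_offdiag {m : ℕ} (B : Matrix (Fin m) (Fin m) ℝ) (r : Fin m → ℝ)
    (hs : ∀ i j, B i j = B j i) (h0 : ∀ i j, 0 ≤ B i j)
    (hr : ∀ i, ∑ j, B i j ≤ r i) (u : Fin m → ℝ) :
    -(∑ i, r i * u i ^ 2) ≤ ∑ i, ∑ j, B i j * (u i * u j) ∧
    ∑ i, ∑ j, B i j * (u i * u j) ≤ ∑ i, r i * u i ^ 2 := by
  have e1 : ∑ i, ∑ j, B i j * u i ^ 2 ≤ ∑ i, r i * u i ^ 2 := by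
    apply Finset.sum_le_sum
    intro i _
    rw [← Finset.sum_mul]
    exact mul_le_mul_of_nonneg_right (hr i) (sq_nonneg _)
  have e2 : ∑ i, ∑ j, B i j * u j ^ 2 = ∑ i, ∑ j, B i j * u i ^ 2 := by
    rw [Finset.sum_comm]
    refine Finset.sum_congr rfl fun i _ => Finset.sum_congr rfl fun j _ => ?_
    rw [hs]
  have p : 0 ≤ ∑ i, ∑ j, B i j * (u i + u j) ^ 2 :=
    Finset.sum_nonneg fun i _ => Finset.sum_nonneg fun j _ => mul_nonneg (h0 i j) (sq_nonneg _)
  have q : 0 ≤ ∑ i, ∑ j, B i j * (u i - u j) ^ 2 :=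
    Finset.sum_nonneg fun i _ => Finset.sum_nonneg fun j _ => mul_nonneg (h0 i j) (sq_nonneg _)
  have ep : ∑ i, ∑ j, B i j * (u i + u j) ^ 2 = ∑ i, ∑ j, B i j * u i ^ 2
      + 2 * ∑ i, ∑ j, B i j * (u i * u j) + ∑ i, ∑ j, B i j * u j ^ 2 := by
    simp only [Finset.mul_sum, ← Finset.sum_add_distrib]
    refine Finset.sum_congr rfl fun i _ => Finset.sum_congr rfl fun j _ => ?_
    ring
  have eq : ∑ i, ∑ j, B i j * (u i - u j) ^ 2 = ∑ i, ∑ j, B i j * u i ^ 2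
      - 2 * ∑ i, ∑ j, B i j * (u i * u j) + ∑ i, ∑ j, B i j * u j ^ 2 := by
    simp only [Finset.mul_sum, ← Finset.sum_add_distrib, ← Finset.sum_sub_distrib]
    refine Finset.sum_congr rfl fun i _ => Finset.sum_congr rfl fun j _ => ?_
    ring
  constructor <;> linarith

theorem aux_row (m : ℕ) (a : ℕ → ℝ) (b : ℝ) (ha : ∀ i, i < m → 0 ≤ a i) (i : ℕ) (hi : i < m)
    (hb : 0 ≤ b) (hab : ∀ k, i = k + 1 → a k = b) :
    ∑ j : Fin m, (if (j : ℕ) = i + 1 then a i else if i = (j : ℕ) + 1 then a j else 0)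
      ≤ a i + b := by
  rw [Fin.sum_univ_eq_sum_range
    (fun j : ℕ => if j = i + 1 then a i else if i = j + 1 then a j else 0)]
  have h1 : ∀ j ∈ Finset.range m, (if j = i + 1 then a i else if i = j + 1 then a j else 0)
      = (if j = i + 1 then a i else 0) + (if j = i - 1 then (if i = j + 1 then b else 0) else 0) := by
    intro j _
    by_cases h : j = i + 1
    · subst h
      have : ¬ (i = i + 1 + 1) := by omega
      simp [this]
    · by_cases h' : i = j + 1
      · subst h'
        have := hab j rfl
        simp [this, h]
      · simp [h, h']
  rw [Finset.sum_congr rfl h1, Finset.sum_add_distrib, Finset.sum_ite_eq', Finset.sum_ite_eq']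
  have := ha i hi
  apply add_le_add <;> split_ifs <;> linarith

theorem pow_pos_aux {a : ℝ} (h : a ≠ 0) : 0 < a ^ 2 := by positivity

/-- Theorem: spectral similarity underlying the cubic smoothing spline
and the weighted Bohlmann–Whittaker filter.  With `A` the symmetric tridiagonal matrix
having diagonal entries `(x_{i+2} − x_i)/3` and off-diagonal entries `(x_{i+2} − x_{i+1})/6`,
and `W = diag((x_{i+2} − x_i)/2)`, one has
`(1/3)·uᵀWu ≤ uᵀAu ≤ uᵀWu` for all `u`; consequently `A` is positive definite and
`K²_n = W A⁻¹ W` and `W` are `(3,1)`-spectrally-similar.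
(Here the `Fin (n−2)` index `i` corresponds to the paper's index `i+1`.) -/
theorem smoothing_spline_bw_spectral_similarity
    (n : ℕ) (hn : 3 ≤ n) (x : ℕ → ℝ)
    (hmono : ∀ i, 1 ≤ i → i < n → x i < x (i + 1))
    (A W : Matrix (Fin (n - 2)) (Fin (n - 2)) ℝ)
    (hA : A = Matrix.of fun (i j : Fin (n - 2)) =>
      if (i : ℕ) = (j : ℕ) then (x ((i : ℕ) + 3) - x ((i : ℕ) + 1)) / 3
      else if (j : ℕ) = (i : ℕ) + 1 then (x ((i : ℕ) + 3) - x ((i : ℕ) + 2)) / 6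
      else if (i : ℕ) = (j : ℕ) + 1 then (x ((j : ℕ) + 3) - x ((j : ℕ) + 2)) / 6
      else 0)
    (hW : W = Matrix.diagonal fun (i : Fin (n - 2)) => (x ((i : ℕ) + 3) - x ((i : ℕ) + 1)) / 2) :
    (∀ u : Fin (n - 2) → ℝ,
      (1 / 3) * (u ⬝ᵥ W.mulVec u) ≤ u ⬝ᵥ A.mulVec u ∧
      u ⬝ᵥ A.mulVec u ≤ u ⬝ᵥ W.mulVec u) ∧
    A.PosDef ∧
    (∀ u : Fin (n - 2) → ℝ,
      1 * (u ⬝ᵥ W.mulVec u) ≤ u ⬝ᵥ (W * A⁻¹ * W).mulVec u ∧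
      u ⬝ᵥ (W * A⁻¹ * W).mulVec u ≤ 3 * (u ⬝ᵥ W.mulVec u)) := by
  have hm : ∀ i : Fin (n - 2), x ((i : ℕ) + 1) < x ((i : ℕ) + 2) ∧ x ((i : ℕ) + 2) < x ((i : ℕ) + 3) := by
    intro i
    have := i.2
    exact ⟨hmono _ (by omega) (by omega), hmono _ (by omega) (by omega)⟩
  have hWu : ∀ u : Fin (n - 2) → ℝ, u ⬝ᵥ W.mulVec u
      = ∑ i : Fin (n - 2), (x ((i : ℕ) + 3) - x ((i : ℕ) + 1)) / 2 * u i ^ 2 := by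
    intro u
    rw [hW]
    simp only [dotProduct, Matrix.mulVec_diagonal]
    refine Finset.sum_congr rfl fun i _ => ?_
    ring
  have hmain : ∀ u : Fin (n - 2) → ℝ,
      (1 / 3) * (u ⬝ᵥ W.mulVec u) ≤ u ⬝ᵥ A.mulVec u ∧
      u ⬝ᵥ A.mulVec u ≤ u ⬝ᵥ W.mulVec u := by
    intro u
    let B : Matrix (Fin (n - 2)) (Fin (n - 2)) ℝ := Matrix.of fun i j =>
      if (j : ℕ) = (i : ℕ) + 1 then (x ((i : ℕ) + 3) - x ((i : ℕ) + 2)) / 6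
      else if (i : ℕ) = (j : ℕ) + 1 then (x ((j : ℕ) + 3) - x ((j : ℕ) + 2)) / 6
      else 0
    have hB := aux_offdiag B (fun i => (x ((i : ℕ) + 3) - x ((i : ℕ) + 1)) / 6)
      (by
        intro i j
        simp only [B, Matrix.of_apply]
        split_ifs <;> first | rfl | omega)
      (by
        intro i j
        have := hm i
        have := hm j
        simp only [B, Matrix.of_apply]
        split_ifs <;> linarith)
      (by
        intro i
        have h := hm i
        have := aux_row (n - 2) (fun i => (x (i + 3) - x (i + 2)) / 6)
          ((x ((i : ℕ) + 2) - x ((i : ℕ) + 1)) / 6)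
          (fun k hk => by have := hm ⟨k, hk⟩; simp only at this ⊢; linarith) i i.2 (by linarith)
          (fun k hk => by simp only [hk])
        simp only [B, Matrix.of_apply]
        refine this.trans (le_of_eq ?_)
        ring) u
    have hAu : u ⬝ᵥ A.mulVec u
        = ∑ i : Fin (n - 2), (x ((i : ℕ) + 3) - x ((i : ℕ) + 1)) / 3 * u i ^ 2
          + ∑ i, ∑ j, B i j * (u i * u j) := by
      rw [← Finset.sum_add_distrib]
      simp only [dotProduct, Matrix.mulVec, Finset.mul_sum]
      refine Finset.sum_congr rfl fun i _ => ?_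
      have : (x ((i : ℕ) + 3) - x ((i : ℕ) + 1)) / 3 * u i ^ 2
          = ∑ j : Fin (n - 2), if i = j then (x ((i : ℕ) + 3) - x ((i : ℕ) + 1)) / 3 * (u i * u j) else 0 := by
        rw [Finset.sum_ite_eq, if_pos (Finset.mem_univ _)]
        ring
      rw [this, ← Finset.sum_add_distrib]
      refine Finset.sum_congr rfl fun j _ => ?_
      rw [hA]
      simp only [B, Matrix.of_apply]
      by_cases h : i = j
      · subst h
        simp
        ring
      · have h' : ¬ (i : ℕ) = (j : ℕ) := fun e => h (Fin.ext e)
        simp only [h, h', if_false]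
        ring
    have s : ∀ c : ℝ, ∑ i : Fin (n - 2), (x ((i : ℕ) + 3) - x ((i : ℕ) + 1)) / c * u i ^ 2
        = (∑ i : Fin (n - 2), (x ((i : ℕ) + 3) - x ((i : ℕ) + 1)) * u i ^ 2) / c := by
      intro c
      rw [Finset.sum_div]
      refine Finset.sum_congr rfl fun i _ => ?_
      ring
    rw [hAu, hWu]
    simp only [s] at hB ⊢
    constructor <;> linarith [hB.1, hB.2]
  have hWn : ∀ u : Fin (n - 2) → ℝ, 0 ≤ u ⬝ᵥ W.mulVec u := by
    intro u
    rw [hWu]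
    exact Finset.sum_nonneg fun i _ => mul_nonneg (by linarith [hm i]) (sq_nonneg _)
  have hAs : Aᵀ = A := by
    ext i j
    rw [hA]
    simp only [Matrix.transpose_apply, Matrix.of_apply]
    split_ifs with h1 <;> first | rfl | omega | simp [h1]
  have hWs : Wᵀ = W := by
    rw [hW, Matrix.diagonal_transpose]
  have hPD : A.PosDef := by
    refine Matrix.PosDef.of_dotProduct_mulVec_pos ?_ ?_
    · rw [Matrix.IsHermitian, Matrix.conjTranspose_eq_transpose_of_trivial, hAs]
    · intro u hu
      rw [star_trivial]
      refine lt_of_lt_of_le ?_ (hmain u).1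
      rw [hWu]
      obtain ⟨k, hk⟩ := Function.ne_iff.mp hu
      refine mul_pos (by norm_num) (Finset.sum_pos' ?_ ⟨k, Finset.mem_univ _, ?_⟩)
      · exact fun i _ => mul_nonneg (by linarith [hm i]) (sq_nonneg _)
      · exact mul_pos (by linarith [hm k]) (pow_pos_aux (by simpa using hk))
  refine ⟨hmain, hPD, ?_⟩
  intro u
  have symA : ∀ a b : Fin (n - 2) → ℝ, a ⬝ᵥ A.mulVec b = b ⬝ᵥ A.mulVec a := by
    intro a b
    rw [Matrix.dotProduct_mulVec, ← Matrix.mulVec_transpose, hAs, dotProduct_comm]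
  have symW : ∀ a b : Fin (n - 2) → ℝ, a ⬝ᵥ W.mulVec b = b ⬝ᵥ W.mulVec a := by
    intro a b
    rw [Matrix.dotProduct_mulVec, ← Matrix.mulVec_transpose, hWs, dotProduct_comm]
  obtain ⟨v, hv⟩ : ∃ v, v = A⁻¹.mulVec (W.mulVec u) := ⟨_, rfl⟩
  have hdet : IsUnit A.det := hPD.det_pos.ne'.isUnit
  have hAv : A.mulVec v = W.mulVec u := by
    rw [hv, Matrix.mulVec_mulVec, Matrix.mul_nonsing_inv _ hdet, Matrix.one_mulVec]
  have hK : (W * A⁻¹ * W).mulVec u = W.mulVec v := by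
    rw [hv, Matrix.mulVec_mulVec, Matrix.mulVec_mulVec, Matrix.mul_assoc]
  have q1 : v ⬝ᵥ A.mulVec v = u ⬝ᵥ W.mulVec v := by rw [hAv, symW]
  have q2 : u ⬝ᵥ A.mulVec v = u ⬝ᵥ W.mulVec u := by rw [hAv]
  have n1 := hWn (u - (1 / 3 : ℝ) • v)
  have n2 : 0 ≤ (u - v) ⬝ᵥ A.mulVec (u - v) := by
    linarith [(hmain (u - v)).1, hWn (u - v)]
  simp only [Matrix.mulVec_sub, Matrix.mulVec_smul, dotProduct_sub, sub_dotProduct,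
    smul_dotProduct, dotProduct_smul, smul_eq_mul] at n1 n2
  rw [symA v u] at n2
  rw [symW v u] at n1
  rw [hK]
  have a1 := hmain u
  have a2 := hmain v
  constructor <;> linarith [a1.1, a1.2, a2.1, a2.2]
end
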